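/- arXiv:1302.7076 — 2 statements merged into one kernel-verified Lean document; each statement's English description precedes it below -/
import Mathlib

section
/- Let G be a finite simple graph on [n] without isolated vertices and I(G) its edge ideal in S = k[x_1,…,x_n]. If S/I(G)^{(2)} is generalized Cohen-Macaulay, then S/I(G)^{(2)} is 3-Buchsbaum, i.e., m^3 · H^i_m(S/I(G)^{(2)}) = 0 for all i < dim S/I(G)^{(2)}. -/
open MvPolynomial CategoryTheory CategoryTheory.Limits

noncomputable section

/-- A simplicial complex on a vertex set `V`: a collection of finite subsets of `V`
closed under taking subsets. -/
def IsSimplicialComplex {V : Type} (Δ : Set (Finset V)) : Prop :=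
  ∀ F ∈ Δ, ∀ G : Finset V, G ⊆ F → G ∈ Δ

/-- The dimension of a simplicial complex: `max {|F| - 1 : F ∈ Δ}`. -/
def complexDim {V : Type} (Δ : Set (Finset V)) : ℤ :=
  sSup ((fun F : Finset V => (F.card : ℤ) - 1) '' Δ)

/-- The star of a face: `st_Δ(F) = {H ∈ Δ : H ∪ F ∈ Δ}`. -/
def complexStar {V : Type} [DecidableEq V] (Δ : Set (Finset V)) (F : Finset V) :
    Set (Finset V) :=
  {H | H ∈ Δ ∧ H ∪ F ∈ Δ}

/-- The facets (maximal faces) of a simplicial complex. -/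
def facets {V : Type} (Δ : Set (Finset V)) : Set (Finset V) :=
  {F | F ∈ Δ ∧ ∀ G ∈ Δ, F ⊆ G → F = G}

/-- The Stanley–Reisner ideal of a simplicial complex `Δ`:
generated by the squarefree monomials `∏_{i ∈ F} x_i` with `F ∉ Δ`. -/
def srIdeal (k : Type) [Field k] {V : Type} (Δ : Set (Finset V)) :
    Ideal (MvPolynomial V k) :=
  Ideal.span {m | ∃ F : Finset V, F ∉ Δ ∧ m = ∏ i ∈ F, X i}

/-- The face prime `P_F = (x_j : j ∉ F)`. -/
def facePrime (k : Type) [Field k] {V : Type} (F : Finset V) :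
    Ideal (MvPolynomial V k) :=
  Ideal.span ((X : V → MvPolynomial V k) '' {j | j ∉ F})

/-- The `m`-th symbolic power of the Stanley–Reisner ideal:
`I_Δ^{(m)} = ⋂_{F facet of Δ} P_F^m`. -/
def symbolicPower (k : Type) [Field k] {V : Type} (Δ : Set (Finset V)) (m : ℕ) :
    Ideal (MvPolynomial V k) :=
  ⨅ F ∈ facets Δ, (facePrime k F) ^ m

/-- The homogeneous maximal ideal `m = (x_1, …, x_n)` of the polynomial ring. -/
def maxIdeal (k : Type) [Field k] (V : Type) : Ideal (MvPolynomial V k) :=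
  Ideal.span (Set.range (X : V → MvPolynomial V k))

/-- The `i`-th local cohomology module `H^i_m(S/I)`. -/
def locCoh (k : Type) [Field k] (V : Type) (I : Ideal (MvPolynomial V k)) (i : ℕ) :
    ModuleCat (MvPolynomial V k) :=
  (localCohomology (maxIdeal k V) i).obj
    (ModuleCat.of (MvPolynomial V k) (MvPolynomial V k ⧸ I))

/-- `S/I` is Cohen–Macaulay: `H^i_m(S/I) = 0` for all `i < dim S/I`. -/
def quotCM (k : Type) [Field k] (V : Type) (I : Ideal (MvPolynomial V k)) : Prop :=
  ∀ i : ℕ, (i : WithBot (WithTop ℕ)) < ringKrullDim (MvPolynomial V k ⧸ I) →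
    Subsingleton (locCoh k V I i)

/-- `S/I` is generalized Cohen–Macaulay: `H^i_m(S/I)` has finite length for all
`i < dim S/I`. -/
def quotGCM (k : Type) [Field k] (V : Type) (I : Ideal (MvPolynomial V k)) : Prop :=
  ∀ i : ℕ, (i : WithBot (WithTop ℕ)) < ringKrullDim (MvPolynomial V k ⧸ I) →
    IsFiniteLength (MvPolynomial V k) (locCoh k V I i)

/-- `S/I` is `r`-Buchsbaum: `m^r · H^i_m(S/I) = 0` for all `i < dim S/I`. -/
def quotKBuchsbaum (k : Type) [Field k] (V : Type) (I : Ideal (MvPolynomial V k))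
    (r : ℕ) : Prop :=
  ∀ i : ℕ, (i : WithBot (WithTop ℕ)) < ringKrullDim (MvPolynomial V k ⧸ I) →
    ∀ x ∈ (maxIdeal k V) ^ r, ∀ y : locCoh k V I i, x • y = 0

/-- The canonical map `Ext^i_S(S/m, S/I) → H^i_m(S/I)`, realized as the colimit
injection at the first power of `m` in the direct system defining local cohomology. -/
def canonicalExtToLocCoh (k : Type) [Field k] (V : Type) (I : Ideal (MvPolynomial V k))
    (i : ℕ) :
    ((localCohomology.diagram (localCohomology.idealPowersDiagram (maxIdeal k V)) i).obj
        (Opposite.op (Opposite.op (1 : ℕ)))).obj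
      (ModuleCat.of (MvPolynomial V k) (MvPolynomial V k ⧸ I)) ⟶ locCoh k V I i :=
  letI := localCohomology.hasColimitDiagram.{0,0}
    (localCohomology.idealPowersDiagram (maxIdeal k V)) i
  (colimit.ι (localCohomology.diagram (localCohomology.idealPowersDiagram (maxIdeal k V)) i)
    (Opposite.op (Opposite.op (1 : ℕ)))).app (ModuleCat.of (MvPolynomial V k) (MvPolynomial V k ⧸ I))

/-- `S/I` is Buchsbaum: the canonical map `Ext^i_S(S/m, S/I) → H^i_m(S/I)` is
surjective for all `i < dim S/I`. -/
def quotBuchsbaum (k : Type) [Field k] (V : Type) (I : Ideal (MvPolynomial V k)) : Prop :=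
  ∀ i : ℕ, (i : WithBot (WithTop ℕ)) < ringKrullDim (MvPolynomial V k ⧸ I) →
    Function.Surjective (canonicalExtToLocCoh k V I i)

/-- A simplicial complex is Cohen–Macaulay if its Stanley–Reisner ring is
Cohen–Macaulay over every field. -/
def complexCM {V : Type} (Δ : Set (Finset V)) : Prop :=
  ∀ (k : Type) [Field k], quotCM k V (srIdeal k Δ)

/-- A simplicial complex is Buchsbaum if its Stanley–Reisner ring is Buchsbaum over
every field. -/
def complexBuchsbaum {V : Type} (Δ : Set (Finset V)) : Prop :=
  ∀ (k : Type) [Field k], quotBuchsbaum k V (srIdeal k Δ)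

/-- The independence complex of a graph: faces are the independent sets. -/
def indepComplex {V : Type} (G : SimpleGraph V) : Set (Finset V) :=
  {F | ∀ i ∈ F, ∀ j ∈ F, ¬ G.Adj i j}

/-- The edge ideal `I(G) = (x_i x_j : ij ∈ E(G))`. -/
def edgeIdeal (k : Type) [Field k] {V : Type} (G : SimpleGraph V) :
    Ideal (MvPolynomial V k) :=
  Ideal.span {m | ∃ i j : V, G.Adj i j ∧ m = X i * X j}

/-- The independence number `α(G)`. -/
def indepNumber {V : Type} (G : SimpleGraph V) : ℕ :=
  sSup {c | ∃ F ∈ indepComplex G, F.card = c}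

/-- A graph is Cohen–Macaulay if its independence complex is. -/
def graphCM {V : Type} (G : SimpleGraph V) : Prop :=
  complexCM (indepComplex G)

/-- The vertex set of the localization `G_{pq} = G \ (N(p) ∪ N(q))` of `G` at an
edge `pq`. -/
def edgeLocSet {V : Type} (G : SimpleGraph V) (p q : V) : Set V :=
  {v | v ∉ G.neighborSet p ∪ G.neighborSet q}

/-- The localization of `G` at an edge `pq`: the induced subgraph on the vertices not
adjacent to `p` or `q` (this removes `p` and `q` as well). -/
def edgeLoc {V : Type} (G : SimpleGraph V) (p q : V) :
    SimpleGraph (edgeLocSet G p q) :=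
  G.induce (edgeLocSet G p q)

/-- `G` is special Cohen–Macaulay: `G` is Cohen–Macaulay and for every edge `pq`,
`G_{pq}` is Cohen–Macaulay with `α(G_{pq}) = α(G) - 1`. -/
def specialCM {V : Type} (G : SimpleGraph V) : Prop :=
  graphCM G ∧ ∀ p q : V, G.Adj p q →
    graphCM (edgeLoc G p q) ∧ indepNumber (edgeLoc G p q) + 1 = indepNumber G

/-- The vertex set of `G_i = G \ ({i} ∪ N(i))`. -/
def vertexLocSet {V : Type} (G : SimpleGraph V) (i : V) : Set V :=
  {v | v ≠ i ∧ v ∉ G.neighborSet i}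

/-- `G_i = G \ ({i} ∪ N(i))`: the induced subgraph obtained by deleting `i` and all
its neighbors. -/
def vertexLoc {V : Type} (G : SimpleGraph V) (i : V) :
    SimpleGraph (vertexLocSet G i) :=
  G.induce (vertexLocSet G i)

/-- A graph is unmixed if all its maximal independent sets have the same cardinality. -/
def graphUnmixed {V : Type} (G : SimpleGraph V) : Prop :=
  ∀ F ∈ facets (indepComplex G), ∀ F' ∈ facets (indepComplex G), F.card = F'.card

/-- `G` has no isolated vertices. -/
def noIsolated {V : Type} (G : SimpleGraph V) : Prop :=
  ∀ v : V, ∃ w : V, G.Adj v w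

end

namespace HomologicalComplex
variable {R : Type} [CommRing R] {ι : Type} {c : ComplexShape ι}
  (K L : HomologicalComplex (ModuleCat.{0} R) c)

/-- The homology class `h` is represented by the chain `x`. -/
def Represents (i : ι) (x : K.X i) (h : K.homology i) : Prop :=
  ∃ z : K.cycles i, K.iCycles i z = x ∧ K.homologyπ i z = h

variable {K L}

lemma Represents.smul {i : ι} {x : K.X i} {h : K.homology i} (hx : K.Represents i x h) (r : R) :
    K.Represents i (r • x) (r • h) := by
  obtain ⟨z, rfl, rfl⟩ := hx
  exact ⟨r • z, by simp, by simp⟩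

lemma Represents.d_eq_zero {i : ι} {x : K.X i} {h : K.homology i} (hx : K.Represents i x h)
    (j : ι) : K.d i j x = 0 := by
  obtain ⟨z, rfl, rfl⟩ := hx
  rw [← ConcreteCategory.comp_apply, K.iCycles_d]; rfl

lemma exists_represents_of_homology {i : ι} (h : K.homology i) :
    ∃ x, K.Represents i x h := by
  obtain ⟨z, rfl⟩ := (ModuleCat.epi_iff_surjective (K.homologyπ i)).1 inferInstance h
  exact ⟨_, z, rfl, rfl⟩

lemma exists_represents_of_d_eq_zero {i : ι} (x : K.X i) (hx : K.d i (c.next i) x = 0) :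
    ∃ h, K.Represents i x h := by
  let f : ModuleCat.of R R ⟶ K.X i := ModuleCat.ofHom (LinearMap.toSpanSingleton R _ x)
  have hf : f ≫ K.d i (c.next i) = 0 := by
    ext; simpa [f] using hx
  refine ⟨_, K.liftCycles f _ rfl hf (1 : R), ?_, rfl⟩
  rw [← ConcreteCategory.comp_apply, K.liftCycles_i]
  simp [f]

lemma Represents.eq_zero_iff {i : ι} {x : K.X i} {h : K.homology i} (hx : K.Represents i x h)
    (p : ι) (hp : c.prev i = p) : h = 0 ↔ ∃ w : K.X p, K.d p i w = x := by
  obtain ⟨z, rfl, rfl⟩ := hx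
  have hex : (ShortComplex.mk _ _ (K.toCycles_comp_homologyπ p i)).Exact :=
    ShortComplex.exact_of_g_is_cokernel _ (K.homologyIsCokernel p i hp)
  rw [ShortComplex.moduleCat_exact_iff] at hex
  have hinj := (ModuleCat.mono_iff_injective (K.iCycles i)).1 inferInstance
  constructor
  · intro h
    obtain ⟨w, rfl⟩ := hex z h
    refine ⟨w, ?_⟩
    rw [← K.toCycles_i]; rfl
  · rintro ⟨w, hw⟩
    have : K.toCycles p i w = z := by
      apply hinj
      rw [← hw, ← K.toCycles_i]; rfl
    rw [← this, ← ConcreteCategory.comp_apply, K.toCycles_comp_homologyπ]; rfl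

lemma Represents.map {i : ι} {x : K.X i} {h : K.homology i} (hx : K.Represents i x h)
    (φ : K ⟶ L) : L.Represents i (φ.f i x) (homologyMap φ i h) := by
  obtain ⟨z, rfl, rfl⟩ := hx
  refine ⟨cyclesMap φ i z, ?_, ?_⟩ <;> simp only [← ConcreteCategory.comp_apply]
  · rw [cyclesMap_i]
  · rw [homologyπ_naturality]

end HomologicalComplex

section
variable {R : Type} [CommRing R]

/-- `Ext` as a left derived functor. -/
noncomputable abbrev derivedExt (n : ℕ) (X Y : ModuleCat.{0} R) : ModuleCat.{0} R :=
  ((_root_.Ext R (ModuleCat.{0} R) n).obj (Opposite.op X)).obj Y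

/-- The map on `derivedExt` induced by a map of the first argument. -/
noncomputable abbrev derivedExtMap (n : ℕ) {X X' : ModuleCat.{0} R} (g : X ⟶ X')
    (Y : ModuleCat.{0} R) : derivedExt n X' Y ⟶ derivedExt n X Y :=
  ((_root_.Ext R (ModuleCat.{0} R) n).map g.op).app Y

variable {X X' : ModuleCat.{0} R} (P : ProjectiveResolution X) (Q : ProjectiveResolution X')
  (Y : ModuleCat.{0} R)

/-- The precomposition with a chain map. -/
def linMap {P Q : ChainComplex (ModuleCat.{0} R) ℕ} (φ : P ⟶ Q) (Y : ModuleCat.{0} R) :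
    Q.linearYonedaObj R Y ⟶ P.linearYonedaObj R Y :=
  (HomologicalComplex.unopFunctor _ _).map
    (((((linearYoneda R (ModuleCat.{0} R)).obj Y).rightOp.mapHomologicalComplex _).map φ).op)

lemma inv_comp_eq_comp_inv {C : Type*} [Category C] {A B A' B' : C} (m : A ⟶ B) (b : B ≅ B')
    (a : A ≅ A') (h : A' ⟶ B') (comm : m ≫ b.hom = a.hom ≫ h) : a.inv ≫ m = h ≫ b.inv := by
  rw [Iso.inv_comp_eq, ← Category.assoc, ← comm, Category.assoc, b.hom_inv_id, Category.comp_id]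

lemma comp_comp_eq_of_squares {C : Type*} [Category C] {A B B' D D' E : C} {a : A ⟶ B} {b : B ⟶ D}
    {c : A ⟶ B'} {d : B' ⟶ D} {e : D ⟶ E} {f : B' ⟶ D'} {g : D' ⟶ E} (h₁ : a ≫ b = c ≫ d)
    (h₂ : d ≫ e = f ≫ g) : a ≫ b ≫ e = (c ≫ f) ≫ g := by
  rw [← Category.assoc, h₁, Category.assoc, h₂, Category.assoc]

lemma isoExt_hom_naturality {X X' : ModuleCat.{0} R} (P : ProjectiveResolution X)
    (Q : ProjectiveResolution X') (g : X ⟶ X') (φ : P.complex ⟶ Q.complex)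
    (comm : φ.f 0 ≫ Q.π.f 0 = P.π.f 0 ≫ g) (n : ℕ) (Y : ModuleCat.{0} R) :
    derivedExtMap n g Y ≫ (P.isoExt (R := R) n Y).hom = (Q.isoExt n Y).hom ≫
      HomologicalComplex.homologyMap (linMap φ Y) n := by
  have h := congrArg Quiver.Hom.unop
    (ProjectiveResolution.isoLeftDerivedObj_inv_naturality g P Q φ comm
    ((linearYoneda R (ModuleCat.{0} R)).obj Y).rightOp n)
  have h2 := HomologicalComplex.homologyOp_hom_naturality (linMap φ Y) n
  have h3 := congrArg Quiver.Hom.unop (inv_comp_eq_comp_inv _ _ _ _ h2)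
  simp only [unop_comp] at h h3
  change _ ≫ (P.isoLeftDerivedObj ((linearYoneda R (ModuleCat.{0} R)).obj Y).rightOp n).inv.unop ≫
    (HomologicalComplex.homologyOp (P.complex.linearYonedaObj R Y) n).inv.unop =
    ((Q.isoLeftDerivedObj ((linearYoneda R (ModuleCat.{0} R)).obj Y).rightOp n).inv.unop ≫
    (HomologicalComplex.homologyOp (Q.complex.linearYonedaObj R Y) n).inv.unop) ≫ _
  exact comp_comp_eq_of_squares h h3

/-- The element `e` of `Ext^n(X, Y)`, the derived functor, is given by the cocycle `f`. -/
def DerivedRep (n : ℕ) {Y : ModuleCat.{0} R} (f : P.complex.X n ⟶ Y) (e : derivedExt n X Y) :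
    Prop :=
  (P.complex.linearYonedaObj R Y).Represents n f ((P.isoExt n Y).hom e)

variable {P Q Y}

lemma DerivedRep.d_comp {n : ℕ} {f : P.complex.X n ⟶ Y} {e : derivedExt n X Y}
    (h : DerivedRep P n f e) (m : ℕ) : P.complex.d m n ≫ f = 0 :=
  HomologicalComplex.Represents.d_eq_zero h m

lemma exists_derivedRep {n : ℕ} (e : derivedExt n X Y) : ∃ f, DerivedRep P n f e :=
  HomologicalComplex.exists_represents_of_homology ((P.isoExt (R := R) n Y).hom e)

lemma exists_derivedExt {n : ℕ} {f : P.complex.X n ⟶ Y} (hf : P.complex.d (n + 1) n ≫ f = 0) :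
    ∃ e, DerivedRep P n f e := by
  obtain ⟨h, hh⟩ := HomologicalComplex.exists_represents_of_d_eq_zero
    (K := P.complex.linearYonedaObj R Y) (i := n) f (by
      rw [CochainComplex.next]; exact hf)
  refine ⟨(P.isoExt n Y).inv h, ?_⟩
  rw [DerivedRep]
  simpa using hh

lemma DerivedRep.smul {n : ℕ} {f : P.complex.X n ⟶ Y} {e : derivedExt n X Y}
    (h : DerivedRep P n f e) (r : R) :
    DerivedRep P n (r • f) (r • e) := by
  rw [DerivedRep, map_smul]
  exact HomologicalComplex.Represents.smul h r

lemma DerivedRep.map {n : ℕ} {f : Q.complex.X n ⟶ Y} {e : derivedExt n X' Y}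
    (h : DerivedRep Q n f e)
    (g : X ⟶ X') (φ : P.complex ⟶ Q.complex) (comm : φ.f 0 ≫ Q.π.f 0 = P.π.f 0 ≫ g) :
    DerivedRep P n (φ.f n ≫ f) (derivedExtMap n g Y e) := by
  have := congrArg (fun a => a e) (isoExt_hom_naturality P Q g φ comm n Y)
  rw [DerivedRep]
  have h' := HomologicalComplex.Represents.map h (linMap φ Y)
  rw [← ConcreteCategory.comp_apply, this]
  exact h'

lemma extMk_zero_eq_zero_iff (f : P.complex.X 0 ⟶ Y) (hf : P.complex.d 1 0 ≫ f = 0) :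
    P.extMk f 1 rfl hf = 0 ↔ f = 0 := by
  refine ⟨fun h => ?_, fun h => by subst h; simp⟩
  rw [← P.extEquivCohomologyClass.apply_eq_iff_eq,
    P.extEquivCohomologyClass_extMk, P.extEquivCohomologyClass_zero,
    CochainComplex.HomComplex.CohomologyClass.mk_eq_zero_iff,
    CochainComplex.HomComplex.Cocycle.toSingleMk_mem_coboundaries_iff _ _ _ _ _ 1 (by lia)] at h
  obtain ⟨g, hg⟩ := h
  have h0 : g = 0 := by
    apply IsZero.eq_of_src
    exact P.cochainComplex.isZero_of_isStrictlyLE 0 1 (by lia)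
  rw [h0, comp_zero] at hg
  rw [← cancel_epi (P.cochainComplexXIso (-(0 : ℕ)) 0 rfl).hom, ← hg, comp_zero]

lemma DerivedRep.eq_zero_iff {n : ℕ} {f : P.complex.X n ⟶ Y} {e : derivedExt n X Y}
    (h : DerivedRep P n f e) :
    e = 0 ↔ P.extMk f (n + 1) rfl (h.d_comp _) = 0 := by
  have he : e = 0 ↔ (P.isoExt n Y).hom e = 0 :=
    ⟨fun h => by rw [h, map_zero], fun h => by
      have := congrArg (P.isoExt n Y).inv h
      simpa using this⟩
  rw [he]
  cases n with
  | zero =>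
    rw [extMk_zero_eq_zero_iff,
      HomologicalComplex.Represents.eq_zero_iff h 0 (by simp)]
    have : (P.complex.linearYonedaObj R Y).d 0 0 = 0 :=
      HomologicalComplex.shape _ _ _ (by simp)
    rw [this]
    exact ⟨fun ⟨w, hw⟩ => hw.symm, fun h => ⟨0, h.symm⟩⟩
  | succ n =>
    rw [ProjectiveResolution.extMk_eq_zero_iff _ _ _ _ _ n rfl,
      HomologicalComplex.Represents.eq_zero_iff h n (by simp)]
    rfl
end

noncomputable section
variable {R : Type} [CommRing R] (m : Ideal R)

/-- The module `R / m ^ t`. -/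
abbrev powQuot (t : ℕ) : ModuleCat.{0} R := ModuleCat.of R (R ⧸ m ^ t)

/-- The projection `R / m ^ t' ⟶ R / m ^ t` for `t ≤ t'`. -/
def powProj {t t' : ℕ} (h : t ≤ t') : powQuot m t' ⟶ powQuot m t :=
  (localCohomology.ringModIdeals (localCohomology.idealPowersDiagram m)).map
    (X := Opposite.op t') (Y := Opposite.op t) (homOfLE h).op

/-- Multiplication by `x` is zero on the colimit of the modules `Ext^i(R / m ^ t, X)`. -/
def KillsLoc (i : ℕ) (X : ModuleCat.{0} R) (x : R) : Prop :=
  ∀ (t : ℕ) (e : Abelian.Ext (powQuot m t) X i), ∃ (t' : ℕ) (h : t ≤ t'),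
    x • (Abelian.Ext.mk₀ (powProj m h)).comp e (zero_add i) = 0

/-- The diagram of functors whose colimit is the `i`-th local cohomology. -/
abbrev locDiagram (i : ℕ) := localCohomology.diagram (localCohomology.idealPowersDiagram m) i

instance (i : ℕ) : HasColimit (locDiagram m i) := localCohomology.hasColimitDiagram.{0,0} _ _

/-- The map from a term of the diagram to its colimit. -/
def locι (i t : ℕ) (X : ModuleCat.{0} R) :
    derivedExt i (powQuot m t) X ⟶ (localCohomology m i).obj X :=
  (colimit.ι (locDiagram m i) (Opposite.op (Opposite.op t))).app X

lemma exists_locι (i : ℕ) (X : ModuleCat.{0} R) (y : (localCohomology m i).obj X) :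
    ∃ t e, locι m i t X e = y := by
  obtain ⟨⟨⟨t⟩⟩, e, he⟩ := Concrete.isColimit_exists_rep (locDiagram m i ⋙ (evaluation _ _).obj X)
    (isColimitOfPreserves ((evaluation _ _).obj X) (colimit.isColimit (locDiagram m i))) y
  exact ⟨t, e, he⟩

lemma locι_map (i : ℕ) {t t' : ℕ} (h : t ≤ t') (X : ModuleCat.{0} R)
    (e : derivedExt i (powQuot m t) X) :
    locι m i t' X (derivedExtMap i (powProj m h) X e) = locι m i t X e := by
  have := congrArg (fun f => f.app X e) (colimit.w (locDiagram m i) (homOfLE h).op.op)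
  exact this

lemma locι_eq_zero_iff (i t : ℕ) (X : ModuleCat.{0} R) (e : derivedExt i (powQuot m t) X) :
    locι m i t X e = 0 ↔ ∃ (t' : ℕ) (h : t ≤ t'), derivedExtMap i (powProj m h) X e = 0 := by
  constructor
  · intro h
    obtain ⟨⟨⟨t'⟩⟩, f, g, hfg⟩ := Concrete.isColimit_exists_of_rep_eq
      (locDiagram m i ⋙ (evaluation _ _).obj X)
      (isColimitOfPreserves ((evaluation _ _).obj X) (colimit.isColimit (locDiagram m i)))
      (i := Opposite.op (Opposite.op t)) (j := Opposite.op (Opposite.op t)) e 0 (by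
        rw [map_zero]; exact h)
    refine ⟨t', leOfHom f.unop.unop, ?_⟩
    rw [map_zero] at hfg
    exact hfg
  · rintro ⟨t', h, he⟩
    rw [← locι_map m i h, he, map_zero]

lemma exists_resolution_lift {X X' : ModuleCat.{0} R} (P : ProjectiveResolution X)
    (Q : ProjectiveResolution X') (g : X ⟶ X') :
    ∃ φ : P.complex ⟶ Q.complex, φ.f 0 ≫ Q.π.f 0 = P.π.f 0 ≫ g := by
  exact ⟨_, ProjectiveResolution.lift_commutes_zero g P Q⟩

lemma killsLoc_iff_aux {X X' Y : ModuleCat.{0} R} (P : ProjectiveResolution X)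
    (Q : ProjectiveResolution X') (g : X ⟶ X') (i : ℕ) (f : Q.complex.X i ⟶ Y)
    (e : derivedExt i X' Y) (hf : DerivedRep Q i f e) (x : R) :
    derivedExtMap i g Y (x • e) = 0 ↔
      x • (Abelian.Ext.mk₀ g).comp (Q.extMk f (i + 1) rfl (hf.d_comp _)) (zero_add i) = 0 := by
  obtain ⟨φ, hφ⟩ := exists_resolution_lift P Q g
  have hφ' : φ.f 0 ≫ Q.π.f 0 = P.π.f 0 ≫ ((ChainComplex.single₀ _).map g).f 0 := hφ
  rw [((hf.smul x).map g φ hφ).eq_zero_iff,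
    ProjectiveResolution.mk₀_comp_extMk f _ rfl (hf.d_comp _) (⟨φ, hφ'⟩ : P.Hom Q g),
    Abelian.Ext.smul_eq_comp_mk₀, ProjectiveResolution.extMk_comp_mk₀]
  simp

lemma killsLoc_iff (i : ℕ) (X : ModuleCat.{0} R) (x : R) :
    KillsLoc m i X x ↔ ∀ y : (localCohomology m i).obj X, x • y = 0 := by
  constructor
  · intro H y
    obtain ⟨t, e, rfl⟩ := exists_locι m i X y
    obtain ⟨f, hf⟩ := exists_derivedRep (P := projectiveResolution (powQuot m t)) e
    obtain ⟨t', h, h'⟩ := H t (ProjectiveResolution.extMk _ f (i + 1) rfl (hf.d_comp _))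
    rw [← map_smul, locι_eq_zero_iff]
    exact ⟨t', h, (killsLoc_iff_aux (projectiveResolution _) _ _ i f e hf x).2 h'⟩
  · intro H t e'
    obtain ⟨f, hf, rfl⟩ := (projectiveResolution (powQuot m t)).extMk_surjective e' (i + 1) rfl
    obtain ⟨e, he⟩ := exists_derivedExt hf
    have := H (locι m i t X e)
    rw [← map_smul, locι_eq_zero_iff] at this
    obtain ⟨t', h, h'⟩ := this
    exact ⟨t', h, (killsLoc_iff_aux (projectiveResolution _) _ _ i f e he x).1 h'⟩

end

section
open Abelian
variable {R : Type} [CommRing R] {m : Ideal R}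

lemma powProj_comp {t t' t'' : ℕ} (h : t ≤ t') (h' : t' ≤ t'') :
    powProj m h' ≫ powProj m h = powProj m (h.trans h') :=
  (Functor.map_comp _ _ _).symm

variable (m) in
/-- The transition maps in the direct system `Ext^i(R/m^t, X)`. -/
noncomputable abbrev pull {t t' : ℕ} (h : t ≤ t') {X : ModuleCat.{0} R} {i : ℕ}
    (e : Ext (powQuot m t) X i) : Ext (powQuot m t') X i :=
  (Ext.mk₀ (powProj m h)).comp e (zero_add i)

lemma pull_pull {t t' t'' : ℕ} (h : t ≤ t') (h' : t' ≤ t'') {X : ModuleCat.{0} R} {i : ℕ}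
    (e : Ext (powQuot m t) X i) : pull m h' (pull m h e) = pull m (h.trans h') e := by
  rw [pull, pull, pull, ← powProj_comp h h', Ext.mk₀_comp_mk₀_assoc]

lemma pull_comp {t t' : ℕ} (h : t ≤ t') {X Y : ModuleCat.{0} R} {i j l : ℕ}
    (e : Ext (powQuot m t) X i) (f : Ext X Y j) (hl : i + j = l) :
    pull m h (e.comp f hl) = (pull m h e).comp f hl :=
  (Ext.comp_assoc _ _ _ _ _ (by lia)).symm

lemma pull_smul {t t' : ℕ} (h : t ≤ t') {X : ModuleCat.{0} R} {i : ℕ}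
    (e : Ext (powQuot m t) X i) (x : R) : pull m h (x • e) = x • pull m h e :=
  Ext.comp_smul _ _ _ _

lemma pull_zero {t t' : ℕ} (h : t ≤ t') {X : ModuleCat.{0} R} {i : ℕ} :
    pull m h (0 : Ext (powQuot m t) X i) = 0 :=
  Ext.comp_zero _ _ _ _ _

lemma killsLoc_iff_pull {i : ℕ} {X : ModuleCat.{0} R} {x : R} :
    KillsLoc m i X x ↔ ∀ (t : ℕ) (e : Ext (powQuot m t) X i), ∃ (t' : ℕ) (h : t ≤ t'),
      x • pull m h e = 0 := Iff.rfl

lemma KillsLoc.exists_pull_eq_zero {i : ℕ} {X : ModuleCat.{0} R} (H : KillsLoc m i X 1) {t : ℕ}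
    (e : Ext (powQuot m t) X i) : ∃ (t' : ℕ) (h : t ≤ t'), pull m h e = 0 := by
  simpa using H t e

lemma killsLoc_one_of_exists {i : ℕ} {X : ModuleCat.{0} R}
    (H : ∀ (t : ℕ) (e : Ext (powQuot m t) X i), ∃ (t' : ℕ) (h : t ≤ t'), pull m h e = 0) :
    KillsLoc m i X 1 := by
  simpa [KillsLoc] using H

variable {S : ShortComplex (ModuleCat.{0} R)}

lemma killsLoc_of_shortExact₃ (hS : S.ShortExact) {j : ℕ} {x : R} (hj : KillsLoc m j S.X₂ 1)
    (h : KillsLoc m (j + 1) S.X₁ x) : KillsLoc m j S.X₃ x := by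
  rw [killsLoc_iff_pull]
  intro t e
  obtain ⟨t', h1, ht'⟩ := killsLoc_iff_pull.1 h t (e.comp hS.extClass rfl)
  rw [pull_comp, ← Ext.smul_comp] at ht'
  obtain ⟨c, hc⟩ := Ext.covariant_sequence_exact₃ _ hS _ rfl ht'
  obtain ⟨t'', h2, ht''⟩ := hj.exists_pull_eq_zero c
  refine ⟨t'', h1.trans h2, ?_⟩
  rw [← pull_pull h1 h2, ← pull_smul, ← hc, pull_comp, ht'', Ext.zero_comp]

lemma killsLoc_of_shortExact₁ (hS : S.ShortExact) {j : ℕ} {x : R} (hj : KillsLoc m (j + 1) S.X₂ 1)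
    (h : KillsLoc m j S.X₃ x) : KillsLoc m (j + 1) S.X₁ x := by
  rw [killsLoc_iff_pull]
  intro t e
  obtain ⟨t', h1, ht'⟩ := hj.exists_pull_eq_zero (e.comp (Ext.mk₀ S.f) (add_zero _))
  rw [pull_comp] at ht'
  obtain ⟨c, hc⟩ := Ext.covariant_sequence_exact₁ _ hS _ ht' rfl
  obtain ⟨t'', h2, ht''⟩ := killsLoc_iff_pull.1 h t' c
  refine ⟨t'', h1.trans h2, ?_⟩
  rw [← pull_pull h1 h2, ← hc, pull_comp, ← Ext.smul_comp, ht'', Ext.zero_comp]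

lemma killsLoc_shift (hS : S.ShortExact) {j : ℕ} {x : R} (hj : KillsLoc m j S.X₂ 1)
    (hj' : KillsLoc m (j + 1) S.X₂ 1) :
    KillsLoc m (j + 1) S.X₁ x ↔ KillsLoc m j S.X₃ x :=
  ⟨killsLoc_of_shortExact₃ hS hj, killsLoc_of_shortExact₁ hS hj'⟩

lemma killsLoc_congr_of_quotient (hS : S.ShortExact) {j : ℕ} {x : R} (hj : KillsLoc m j S.X₃ 1)
    (hj' : KillsLoc m (j + 1) S.X₃ 1) :
    KillsLoc m (j + 1) S.X₁ x ↔ KillsLoc m (j + 1) S.X₂ x := by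
  constructor <;> intro h t e
  · obtain ⟨t', h1, ht'⟩ := hj'.exists_pull_eq_zero (e.comp (Ext.mk₀ S.g) (add_zero _))
    rw [pull_comp] at ht'
    obtain ⟨c, hc⟩ := Ext.covariant_sequence_exact₂ _ hS _ ht'
    obtain ⟨t'', h2, ht''⟩ := killsLoc_iff_pull.1 h t' c
    refine ⟨t'', h1.trans h2, ?_⟩
    rw [← pull, ← pull_pull h1 h2, ← hc, pull_comp, ← Ext.smul_comp, ht'', Ext.zero_comp]
  · obtain ⟨t', h1, ht'⟩ := killsLoc_iff_pull.1 h t (e.comp (Ext.mk₀ S.f) (add_zero _))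
    rw [pull_comp, ← Ext.smul_comp] at ht'
    obtain ⟨c, hc⟩ := Ext.covariant_sequence_exact₁ _ hS _ ht' rfl
    obtain ⟨t'', h2, ht''⟩ := hj.exists_pull_eq_zero c
    refine ⟨t'', h1.trans h2, ?_⟩
    rw [← pull, ← pull_pull h1 h2, ← pull_smul, ← hc, pull_comp, ht'', Ext.zero_comp]

lemma killsLoc_congr_of_sub (hS : S.ShortExact) {j : ℕ} {x : R} (hj : KillsLoc m j S.X₁ 1)
    (hj' : KillsLoc m (j + 1) S.X₁ 1) :
    KillsLoc m j S.X₂ x ↔ KillsLoc m j S.X₃ x := by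
  constructor <;> intro h t e
  · obtain ⟨t', h1, ht'⟩ := hj'.exists_pull_eq_zero (e.comp hS.extClass rfl)
    rw [pull_comp] at ht'
    obtain ⟨c, hc⟩ := Ext.covariant_sequence_exact₃ _ hS _ rfl ht'
    obtain ⟨t'', h2, ht''⟩ := killsLoc_iff_pull.1 h t' c
    refine ⟨t'', h1.trans h2, ?_⟩
    rw [← pull, ← pull_pull h1 h2, ← hc, pull_comp, ← Ext.smul_comp, ht'', Ext.zero_comp]
  · obtain ⟨t', h1, ht'⟩ := killsLoc_iff_pull.1 h t (e.comp (Ext.mk₀ S.g) (add_zero _))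
    rw [pull_comp, ← Ext.smul_comp] at ht'
    obtain ⟨c, hc⟩ := Ext.covariant_sequence_exact₂ _ hS _ ht'
    obtain ⟨t'', h2, ht''⟩ := hj.exists_pull_eq_zero c
    refine ⟨t'', h1.trans h2, ?_⟩
    rw [← pull, ← pull_pull h1 h2, ← pull_smul, ← hc, pull_comp, ht'', Ext.zero_comp]

lemma KillsLoc.of_iso {i : ℕ} {X Y : ModuleCat.{0} R} (f : X ≅ Y) {x : R}
    (h : KillsLoc m i X x) : KillsLoc m i Y x := by
  intro t e
  obtain ⟨t', h1, ht'⟩ := killsLoc_iff_pull.1 h t (e.comp (Ext.mk₀ f.inv) (add_zero _))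
  refine ⟨t', h1, ?_⟩
  have := congrArg (fun e => e.comp (Ext.mk₀ f.hom) (add_zero _)) ht'
  rwa [pull_comp, Ext.smul_comp, Ext.comp_assoc_of_third_deg_zero, Ext.mk₀_comp_mk₀,
    f.inv_hom_id, Ext.comp_mk₀_id, Ext.zero_comp] at this

lemma exists_powQuot_hom {X : ModuleCat.{0} R} (y : X) (t : ℕ) (hy : ∀ r ∈ m ^ t, r • y = 0) :
    ∃ f : powQuot m t ⟶ X, f (Ideal.Quotient.mk _ 1) = y := by
  refine ⟨ModuleCat.ofHom (Submodule.liftQ (m ^ t) (LinearMap.toSpanSingleton R X y) ?_), ?_⟩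
  · intro r hr
    rw [LinearMap.mem_ker, LinearMap.toSpanSingleton_apply]
    exact hy r hr
  · refine (Submodule.liftQ_apply _ _ _).trans ?_
    rw [LinearMap.toSpanSingleton_apply, one_smul]

lemma powQuot_hom_ext {X : ModuleCat.{0} R} {t : ℕ} {f g : powQuot m t ⟶ X}
    (h : f (Ideal.Quotient.mk _ 1) = g (Ideal.Quotient.mk _ 1)) : f = g := by
  refine ModuleCat.hom_ext (LinearMap.ext fun r => ?_)
  obtain ⟨r, rfl⟩ := Ideal.Quotient.mk_surjective r
  have : Ideal.Quotient.mk (m ^ t) r = r • Ideal.Quotient.mk (m ^ t) 1 := by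
    rw [map_one, Algebra.smul_def, mul_one]; rfl
  rw [this, map_smul, map_smul, h]

lemma powQuot_hom_smul {X : ModuleCat.{0} R} {t : ℕ} (f : powQuot m t ⟶ X)
    (r : R) (hr : r ∈ m ^ t) :
    r • f (Ideal.Quotient.mk _ 1) = 0 := by
  have : r • Ideal.Quotient.mk (m ^ t) 1 = 0 := by
    rw [Algebra.smul_def]; simpa [Ideal.Quotient.eq_zero_iff_mem] using hr
  rw [← map_smul, this, map_zero]

lemma killsLoc_zero_iff {X : ModuleCat.{0} R} {x : R} :
    KillsLoc m 0 X x ↔ ∀ (y : X) (t : ℕ), (∀ r ∈ m ^ t, r • y = 0) → x • y = 0 := by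
  constructor
  · intro h y t hy
    obtain ⟨f, hf⟩ := exists_powQuot_hom y t hy
    obtain ⟨t', h1, ht'⟩ := h t (Ext.mk₀ f)
    rw [Ext.mk₀_comp_mk₀, ← Ext.mk₀_smul, ← Ext.mk₀_zero] at ht'
    have := (Ext.mk₀_bijective _ _).1 ht'
    have h2 := congrArg (fun f => f (Ideal.Quotient.mk (m ^ t') 1)) this
    rw [← hf]
    exact h2
  · intro h t e
    obtain ⟨f, rfl⟩ := (Ext.mk₀_bijective _ _).2 e
    refine ⟨t, le_rfl, ?_⟩
    rw [Ext.mk₀_comp_mk₀, ← Ext.mk₀_smul, ← Ext.mk₀_zero]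
    congr 1
    apply powQuot_hom_ext
    exact h _ t (powQuot_hom_smul f)

lemma KillsLoc.zero_of_injective {X Y : ModuleCat.{0} R} (f : X ⟶ Y) (hf : Function.Injective f)
    {x : R} (h : KillsLoc m 0 Y x) : KillsLoc m 0 X x := by
  rw [killsLoc_zero_iff] at h ⊢
  intro y t hy
  apply hf
  rw [map_smul, map_zero]
  exact h _ t fun r hr => by rw [← map_smul, hy r hr, map_zero]

lemma ModuleCat.shortExact_of {A C B : ModuleCat.{0} R} (f : A ⟶ C) (g : C ⟶ B)
    (hf : Function.Injective f) (hg : Function.Surjective g) (h : Function.Exact f g) :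
    (ShortComplex.mk f g (by ext a; exact h.apply_apply_eq_zero a)).ShortExact where
  exact := by
    rw [ShortComplex.moduleCat_exact_iff]
    exact fun x hx => (h x).1 hx
  mono_f := (ModuleCat.mono_iff_injective f).2 hf
  epi_g := (ModuleCat.epi_iff_surjective g).2 hg

end

section
open Abelian
variable {R : Type} [CommRing R] (m : Ideal R)

/-- Every element is annihilated by some power of `m`. -/
def PowTorsion (A : Type) [AddCommGroup A] [Module R A] : Prop :=
  ∀ a : A, ∃ t, ∀ r ∈ m ^ t, r • a = 0

/-- The submodule of elements annihilated by some power of `m`. -/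
def powTorsion (A : Type) [AddCommGroup A] [Module R A] : Submodule R A where
  carrier := {a | ∃ t, ∀ r ∈ m ^ t, r • a = 0}
  zero_mem' := ⟨0, by simp⟩
  add_mem' := by
    rintro a b ⟨t, ht⟩ ⟨s, hs⟩
    refine ⟨max t s, fun r hr => ?_⟩
    rw [smul_add, ht r (Ideal.pow_le_pow_right (le_max_left _ _) hr),
      hs r (Ideal.pow_le_pow_right (le_max_right _ _) hr), add_zero]
  smul_mem' := by
    rintro c a ⟨t, ht⟩
    exact ⟨t, fun r hr => by rw [smul_comm, ht r hr, smul_zero]⟩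

lemma exists_pow_smul_eq_zero_of_fg {A M : Type} [AddCommGroup A] [Module R A] [AddCommGroup M]
    [Module R M] [Module.Finite R M] (f : M →ₗ[R] A) (h : ∀ x, ∃ t, ∀ r ∈ m ^ t, r • f x = 0) :
    ∃ t, ∀ x, ∀ r ∈ m ^ t, r • f x = 0 := by
  obtain ⟨s, hs⟩ := (Module.Finite.fg_top : (⊤ : Submodule R M).FG)
  choose t ht using h
  refine ⟨s.sup t, fun x => ?_⟩
  have hx : x ∈ Submodule.span R (s : Set M) := by rw [hs]; trivial
  induction hx using Submodule.span_induction with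
  | mem x hx => exact fun r hr => ht x r (Ideal.pow_le_pow_right (Finset.le_sup (f := t) hx) hr)
  | zero => simp
  | add x y _ _ hx hy => intro r hr; rw [map_add, smul_add, hx r hr, hy r hr, add_zero]
  | smul a x _ hx => intro r hr; rw [map_smul, smul_comm, hx r hr, smul_zero]

lemma map_eq_zero_of_mem_pow_smul {A : Type} [AddCommGroup A] [Module R A] {J : Ideal R}
    (f : J →ₗ[R] A) {t : ℕ} (hf : ∀ x, ∀ r ∈ m ^ t, r • f x = 0) {z : R} (hz : z ∈ m ^ t • J) :
    ∀ hz' : z ∈ J, f ⟨z, hz'⟩ = 0 := by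
  refine (Submodule.smul_induction_on (p := fun z => z ∈ J ∧ ∀ hz' : z ∈ J, f ⟨z, hz'⟩ = 0)
    hz ?_ ?_).2
  · intro r hr y hy
    exact ⟨J.smul_mem r hy, fun hz' => (map_smul f r ⟨y, hy⟩).trans (hf _ r hr)⟩
  · rintro y z ⟨hy, hfy⟩ ⟨hz, hfz⟩
    refine ⟨add_mem hy hz, fun hz' => (map_add f ⟨y, hy⟩ ⟨z, hz⟩).trans ?_⟩
    rw [hfy, hfz, add_zero]

lemma exists_pow_ker_le [IsNoetherianRing R] {A : Type} [AddCommGroup A] [Module R A] {J : Ideal R}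
    (f : J →ₗ[R] A) (hf : ∀ x, ∃ t, ∀ r ∈ m ^ t, r • f x = 0) :
    ∃ s, ∀ y : J, (y : R) ∈ m ^ s → f y = 0 := by
  obtain ⟨t, ht⟩ := exists_pow_smul_eq_zero_of_fg m f hf
  obtain ⟨c, hc⟩ := Ideal.exists_pow_inf_eq_pow_smul m (N := J)
  refine ⟨t + c, fun y hy => map_eq_zero_of_mem_pow_smul m f ht (z := y) ?_ y.2⟩
  have h1 := hc (t + c) (Nat.le_add_left _ _)
  have h2 : (y : R) ∈ (m ^ (t + c) • ⊤ ⊓ J : Submodule R R) := ⟨by simpa using hy, y.2⟩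
  rw [h1, Nat.add_sub_cancel] at h2
  exact Submodule.smul_mono le_rfl inf_le_right h2

lemma injective_powTorsion [IsNoetherianRing R] (E : Type) [AddCommGroup E] [Module R E]
    [hE : Module.Injective R E] : Module.Injective R (powTorsion m E) := by
  apply Module.Baer.injective
  intro J g
  obtain ⟨s, hs⟩ := exists_pow_ker_le m ((powTorsion m E).subtype ∘ₗ g) (fun x => (g x).2)
  let u : J →ₗ[R] R ⧸ m ^ s := (m ^ s).mkQ ∘ₗ J.subtype
  have hu : u.ker ≤ ((powTorsion m E).subtype ∘ₗ g).ker := by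
    intro y hy
    exact hs y ((Submodule.Quotient.mk_eq_zero _).1 hy)
  obtain ⟨h, hh⟩ := Module.Injective.out (u.ker.liftQ u le_rfl)
    (LinearMap.ker_eq_bot.1 (Submodule.ker_liftQ_eq_bot' _ _ rfl))
    (u.ker.liftQ ((powTorsion m E).subtype ∘ₗ g) hu)
  refine ⟨LinearMap.codRestrict (powTorsion m E) (h ∘ₗ (m ^ s).mkQ) ?_, ?_⟩
  · intro x
    refine ⟨s, fun r hr => ?_⟩
    rw [← map_smul]
    have : r • x ∈ m ^ s := Ideal.mul_mem_right _ _ hr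
    rw [LinearMap.comp_apply, Submodule.mkQ_apply, (Submodule.Quotient.mk_eq_zero _).2 this,
      map_zero]
  · intro x hx
    ext
    exact hh (Submodule.Quotient.mk ⟨x, hx⟩)

variable {m}

lemma smul_ext_powQuot_eq_zero {t : ℕ} {r : R} (hr : r ∈ m ^ t) {X : ModuleCat.{0} R} {i : ℕ}
    (e : Ext (powQuot m t) X i) : r • e = 0 := by
  rw [← Ext.mk₀_id_comp e, ← Ext.smul_comp, ← Ext.mk₀_smul]
  have : r • 𝟙 (powQuot m t) = 0 := powQuot_hom_ext (powQuot_hom_smul (𝟙 _) r hr)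
  rw [this, Ext.mk₀_zero, Ext.zero_comp]

lemma killsLoc_one_of_injective (X : ModuleCat.{0} R) [Injective X] (j : ℕ) :
    KillsLoc m (j + 1) X 1 :=
  killsLoc_one_of_exists fun t e => ⟨t, le_rfl, by rw [Ext.eq_zero_of_injective e, pull_zero]⟩

lemma killsLoc_one_of_shortExact {S : ShortComplex (ModuleCat.{0} R)} (hS : S.ShortExact)
    (hI : KillsLoc m 1 S.X₂ 1) (ht : PowTorsion m S.X₂) : KillsLoc m 1 S.X₁ 1 := by
  refine killsLoc_one_of_exists fun t e => ?_
  obtain ⟨t', h1, ht'⟩ := hI.exists_pull_eq_zero (e.comp (Ext.mk₀ S.f) (add_zero _))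
  rw [pull_comp] at ht'
  obtain ⟨c, hc⟩ := Ext.covariant_sequence_exact₁ _ hS _ ht' (zero_add 1)
  obtain ⟨φ, rfl⟩ := (Ext.mk₀_bijective _ _).2 c
  obtain ⟨z, hz⟩ := (ModuleCat.epi_iff_surjective S.g).1 hS.epi_g (φ (Ideal.Quotient.mk _ 1))
  obtain ⟨s, hs⟩ := ht z
  obtain ⟨ψ, hψ⟩ := exists_powQuot_hom (m := m) z (max t' s) fun r hr =>
    hs r (Ideal.pow_le_pow_right (le_max_right _ _) hr)
  have h2 : powProj m (le_max_left t' s) ≫ φ = ψ ≫ S.g := by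
    apply powQuot_hom_ext
    rw [ConcreteCategory.comp_apply, ConcreteCategory.comp_apply, hψ, hz]; rfl
  refine ⟨max t' s, h1.trans (le_max_left _ _), ?_⟩
  rw [← pull_pull h1 (le_max_left _ _), ← hc, pull_comp, pull, Ext.mk₀_comp_mk₀, h2,
    ← Ext.mk₀_comp_mk₀, Ext.comp_assoc _ _ _ _ (zero_add 1) (by lia), hS.comp_extClass,
    Ext.comp_zero]

lemma PowTorsion.exists_shortExact [IsNoetherianRing R] {A : ModuleCat.{0} R}
    (hA : PowTorsion m A) : ∃ S : ShortComplex (ModuleCat.{0} R), S.ShortExact ∧ S.X₁ = A ∧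
      Injective S.X₂ ∧ PowTorsion m S.X₂ ∧ PowTorsion m S.X₃ := by
  let E := Injective.under A
  have hE : Injective (ModuleCat.of R E) := (inferInstance : Injective (Injective.under A))
  have : Module.Injective R E := Module.injective_module_of_injective_object R E
  let I := ModuleCat.of R (powTorsion m E)
  have := injective_powTorsion m E
  have hI : Injective I := Module.injective_object_of_injective_module R (powTorsion m E)
  have hIt : PowTorsion m I := fun a => by
    obtain ⟨t, ht⟩ := a.2
    exact ⟨t, fun r hr => Subtype.ext (ht r hr)⟩
  let f : A →ₗ[R] powTorsion m E := LinearMap.codRestrict _ (Injective.ι A).hom (fun a => by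
    obtain ⟨t, ht⟩ := hA a
    exact ⟨t, fun r hr => by rw [← map_smul, ht r hr, map_zero]⟩)
  have hf : Function.Injective f := fun a b h =>
    (ModuleCat.mono_iff_injective (Injective.ι A)).1 inferInstance (congrArg Subtype.val h)
  have hS := ModuleCat.shortExact_of (ModuleCat.ofHom f) (ModuleCat.ofHom f.range.mkQ) hf
    (Submodule.mkQ_surjective _) (LinearMap.exact_map_mkQ_range f)
  refine ⟨_, hS, rfl, hI, hIt, fun y => ?_⟩
  obtain ⟨y, rfl⟩ := Submodule.mkQ_surjective _ y
  obtain ⟨t, ht⟩ := hIt y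
  exact ⟨t, fun r hr => (map_smul f.range.mkQ r y).symm.trans
    ((congrArg _ (ht r hr)).trans (map_zero _))⟩

lemma PowTorsion.killsLoc [IsNoetherianRing R] (j : ℕ) : ∀ {A : ModuleCat.{0} R},
    PowTorsion m A → KillsLoc m (j + 1) A 1 := by
  induction j with
  | zero =>
    intro A hA
    obtain ⟨S, hS, rfl, hI, hIt, -⟩ := hA.exists_shortExact
    exact killsLoc_one_of_shortExact hS (killsLoc_one_of_injective _ 0) hIt
  | succ j ih =>
    intro A hA
    obtain ⟨S, hS, rfl, hI, -, hQ⟩ := hA.exists_shortExact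
    exact killsLoc_of_shortExact₁ hS (killsLoc_one_of_injective _ _) (ih hQ)

lemma killsLoc_one_of_locally_divisible {X : Type} [AddCommGroup X] [Module R X]
    {ι : Type} [Fintype ι]
    (p : ι → X →ₗ[R] X) (hp : ∀ x, ∑ s, p s x = x)
    (hdiv : ∀ s, ∃ x ∈ m, ∀ t : ℕ, ∃ g : X →ₗ[R] X, p s = x ^ t • g) (j : ℕ) :
    KillsLoc m j (ModuleCat.of R X) 1 := by
  refine killsLoc_one_of_exists fun t e => ⟨t, le_rfl, ?_⟩
  have hsum : ∑ s, ModuleCat.ofHom (p s) = 𝟙 (ModuleCat.of R X) := by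
    ext x
    simpa [ModuleCat.hom_sum] using hp x
  have : e = 0 := by
    rw [← Ext.comp_mk₀_id e, ← hsum, Ext.mk₀_sum, Ext.comp_sum]
    refine Finset.sum_eq_zero fun s _ => ?_
    obtain ⟨x, hx, h⟩ := hdiv s
    obtain ⟨g, hg⟩ := h t
    have : ModuleCat.ofHom (x ^ t • g) = x ^ t • ModuleCat.ofHom g := rfl
    rw [hg, this, Ext.mk₀_smul, Ext.comp_smul]
    exact smul_ext_powQuot_eq_zero (Ideal.pow_mem_pow hx t) _
  rw [this, pull_zero]
end

section
open Abelian
variable {R : Type} [CommRing R] {m : Ideal R}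

lemma PowTorsion.killsLoc_zero_iff {A : ModuleCat.{0} R} (hA : PowTorsion m A) {x : R} :
    KillsLoc m 0 A x ↔ ∀ y : A, x • y = 0 := by
  rw [_root_.killsLoc_zero_iff]
  exact ⟨fun h y => (hA y).elim fun t ht => h y t ht, fun h y _ _ => h y⟩

lemma exists_pow_smul_eq_zero_of_isFiniteLength {i : ℕ} {X : ModuleCat.{0} R}
    (h : IsFiniteLength R ((localCohomology m i).obj X)) :
    ∃ s, ∀ x ∈ m ^ s, ∀ y : (localCohomology m i).obj X, x • y = 0 := by
  have : IsNoetherian R ((localCohomology m i).obj X) :=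
    (isFiniteLength_iff_isNoetherian_isArtinian.1 h).1
  obtain ⟨s, hs⟩ := exists_pow_smul_eq_zero_of_fg m
    (LinearMap.id : ((localCohomology m i).obj X) →ₗ[R] _) fun y => by
      obtain ⟨t, e, rfl⟩ := exists_locι m i X y
      refine ⟨t, fun r hr => ?_⟩
      obtain ⟨f, hf⟩ := exists_derivedRep (P := projectiveResolution (powQuot m t)) e
      rw [LinearMap.id_apply, ← map_smul, locι_eq_zero_iff]
      exact ⟨t, le_rfl, (killsLoc_iff_aux (projectiveResolution _) _ _ i f e hf r).2
        (smul_ext_powQuot_eq_zero hr _)⟩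
  exact ⟨s, fun x hx y => hs y x hx⟩

variable {C : ℕ → Type} [∀ i, AddCommGroup (C i)] [∀ i, Module R (C i)]
  (d : ∀ i, C i →ₗ[R] C (i + 1))

/-- The coboundaries of a complex. -/
def coboundaries : ∀ i, Submodule R (C i)
  | 0 => ⊥
  | i + 1 => (d i).range

/-- The cohomology of a complex. -/
abbrev cohomologyQuot (i : ℕ) : Type :=
  (d i).ker ⧸ (coboundaries d i).submoduleOf (d i).ker

lemma powTorsion_cohomologyQuot
    (hH : ∀ i z, d i z = 0 → ∃ t, ∀ r ∈ m ^ t, r • z ∈ coboundaries d i) (i : ℕ) :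
    PowTorsion m (cohomologyQuot d i) := by
  intro z
  obtain ⟨z, rfl⟩ := Submodule.mkQ_surjective _ z
  obtain ⟨t, ht⟩ := hH i z z.2
  refine ⟨t, fun r hr => ?_⟩
  rw [← map_smul]
  exact (Submodule.Quotient.mk_eq_zero _).2 (ht r hr)

lemma shortExact_ker_range (i : ℕ) :
    (ShortComplex.mk (ModuleCat.ofHom (d i).ker.subtype) (ModuleCat.ofHom (d i).rangeRestrict)
      (by ext x; exact x.2)).ShortExact :=
  ModuleCat.shortExact_of _ _ (Submodule.subtype_injective _) (LinearMap.surjective_rangeRestrict _)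
    (by
      rw [LinearMap.exact_iff]
      simp)

lemma coboundaries_le_ker (hd : ∀ i x, d (i + 1) (d i x) = 0) (i : ℕ) :
    coboundaries d i ≤ (d i).ker := by
  cases i with
  | zero => exact bot_le
  | succ i => rintro _ ⟨x, rfl⟩; exact hd i x

lemma exists_shortExact_cohomologyQuot (hd : ∀ i x, d (i + 1) (d i x) = 0) (i : ℕ) :
    ∃ S : ShortComplex (ModuleCat.{0} R), S.ShortExact ∧ S.X₁ = ModuleCat.of R (coboundaries d i) ∧
      S.X₂ = ModuleCat.of R (d i).ker ∧ S.X₃ = ModuleCat.of R (cohomologyQuot d i) :=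
  ⟨_, ModuleCat.shortExact_of
    (ModuleCat.ofHom (Submodule.inclusion (coboundaries_le_ker d hd i)))
    (ModuleCat.ofHom ((coboundaries d i).submoduleOf (d i).ker).mkQ)
    (Submodule.inclusion_injective (coboundaries_le_ker d hd i)) (Submodule.mkQ_surjective _)
    (by
      have h := coboundaries_le_ker d hd i
      rw [LinearMap.exact_iff]
      exact (Submodule.ker_mkQ _).trans (Submodule.range_inclusion _ _ h).symm), rfl, rfl, rfl⟩

variable [IsNoetherianRing R]

lemma killsLoc_coboundaries_iff (hd : ∀ i x, d (i + 1) (d i x) = 0)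
    (hC : ∀ i j, KillsLoc m j (ModuleCat.of R (C (i + 1))) 1)
    (hH : ∀ i z, d i z = 0 → ∃ t, ∀ r ∈ m ^ t, r • z ∈ coboundaries d i)
    {x : R} (j : ℕ) : ∀ p q, q = p + 1 + j →
    (KillsLoc m (j + 1) (ModuleCat.of R (coboundaries d (p + 1))) x ↔
      KillsLoc m 0 (ModuleCat.of R (cohomologyQuot d q)) x) := by
  have hZ (p : ℕ) : KillsLoc m 0 (ModuleCat.of R (d (p + 1)).ker) 1 :=
    (hC p 0).zero_of_injective (ModuleCat.ofHom (d (p + 1)).ker.subtype)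
      (Submodule.subtype_injective _)
  have hB (p : ℕ) : KillsLoc m 0 (ModuleCat.of R (coboundaries d (p + 1))) 1 :=
    (hC p 0).zero_of_injective (ModuleCat.ofHom (coboundaries d (p + 1)).subtype)
      (Submodule.subtype_injective _)
  have hZ1 (p : ℕ) : KillsLoc m 1 (ModuleCat.of R (d (p + 1)).ker) 1 :=
    killsLoc_of_shortExact₁ (shortExact_ker_range d (p + 1)) (hC p 1) (hB (p + 1))
  induction j with
  | zero =>
    rintro p q rfl
    obtain ⟨⟨S⟩, hS, rfl, rfl, rfl⟩ := exists_shortExact_cohomologyQuot d hd (p + 1)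
    exact killsLoc_shift hS (hZ p) (hZ1 p)
  | succ j ih =>
    rintro p q rfl
    have hH' := powTorsion_cohomologyQuot d hH
    obtain ⟨⟨S⟩, hS, rfl, rfl, rfl⟩ := exists_shortExact_cohomologyQuot d hd (p + 1)
    refine (killsLoc_congr_of_quotient hS ((hH' (p + 1)).killsLoc j)
      ((hH' (p + 1)).killsLoc (j + 1))).trans ?_
    refine (killsLoc_shift (shortExact_ker_range d (p + 1)) (hC p (j + 1)) (hC p (j + 2))).trans ?_
    exact ih (p + 1) _ (by lia)

/-- A complex whose terms in positive degrees have no local cohomology and whose cohomology is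
torsion computes the local cohomology of its initial term. -/
theorem killsLoc_iff_of_complex (hd : ∀ i x, d (i + 1) (d i x) = 0)
    (hC : ∀ i j, KillsLoc m j (ModuleCat.of R (C (i + 1))) 1)
    (hH : ∀ i z, d i z = 0 → ∃ t, ∀ r ∈ m ^ t, r • z ∈ coboundaries d i)
    (i : ℕ) (x : R) :
    KillsLoc m i (ModuleCat.of R (C 0)) x ↔ ∀ z, d i z = 0 → x • z ∈ coboundaries d i := by
  cases i with
  | zero =>
    rw [killsLoc_zero_iff]
    constructor
    · intro h z hz
      obtain ⟨t, ht⟩ := hH 0 z hz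
      exact h z t ht
    · intro h y t hy
      refine h y ?_
      have := killsLoc_zero_iff.1 (hC 0 0) (d 0 y) t fun r hr => by
        rw [← map_smul, hy r hr, map_zero]
      rwa [one_smul] at this
  | succ j =>
    have hH' := powTorsion_cohomologyQuot d hH
    have h0 : PowTorsion m (ModuleCat.of R (d 0).ker) := fun z => by
      obtain ⟨t, ht⟩ := hH 0 z z.2
      exact ⟨t, fun r hr => Subtype.ext (ht r hr)⟩
    refine (killsLoc_congr_of_sub (shortExact_ker_range d 0) (h0.killsLoc j)
      (h0.killsLoc (j + 1))).trans ?_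
    refine (killsLoc_coboundaries_iff d hd hC hH j 0 (j + 1) (by lia)).trans ?_
    rw [(hH' (j + 1)).killsLoc_zero_iff]
    constructor
    · intro h z hz
      have := h (Submodule.mkQ _ ⟨z, hz⟩)
      rw [← map_smul] at this
      exact (Submodule.Quotient.mk_eq_zero
        ((coboundaries d (j + 1)).submoduleOf (d (j + 1)).ker)).1 this
    · intro h y
      obtain ⟨y, rfl⟩ := Submodule.mkQ_surjective _ y
      rw [← map_smul]
      exact (Submodule.Quotient.mk_eq_zero _).2 (h y y.2)

end

section Cech
variable {n : ℕ} {M N : Type} [AddCommGroup M] [AddCommGroup N]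

/-- The sign of `j` in the finite set `σ`. -/
def cechSign (j : Fin n) (σ : Finset (Fin n)) : ℤ := ∏ l ∈ σ, if l < j then -1 else 1

/-- The Čech differential. -/
def cechD (f : Finset (Fin n) → M) : Finset (Fin n) → M :=
  fun σ => ∑ j ∈ σ, cechSign j σ • f (σ.erase j)

/-- The contracting homotopy of the Čech complex at the vertex `a`. -/
def cechH (a : Fin n) (f : Finset (Fin n) → M) : Finset (Fin n) → M :=
  fun σ => if a ∈ σ then 0 else cechSign a (insert a σ) • f (insert a σ)

lemma cechSign_mul_self (j : Fin n) (σ : Finset (Fin n)) : cechSign j σ * cechSign j σ = 1 := by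
  rw [cechSign, ← Finset.prod_mul_distrib]
  exact Finset.prod_eq_one fun l _ => by split_ifs <;> simp

lemma cechSign_erase {j l : Fin n} {σ : Finset (Fin n)} (hl : l ∈ σ) :
    cechSign j (σ.erase l) = cechSign j σ * if l < j then -1 else 1 := by
  have h := Finset.mul_prod_erase σ (fun l => if l < j then (-1 : ℤ) else 1) hl
  have h' := cechSign_mul_self j {l}
  rw [cechSign, cechSign, ← h]
  split_ifs <;> simp

lemma cechSign_mul_erase {j l : Fin n} {σ : Finset (Fin n)} (hj : j ∈ σ) (hl : l ∈ σ)
    (hjl : j ≠ l) :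
    cechSign j σ * cechSign l (σ.erase j) = -(cechSign l σ * cechSign j (σ.erase l)) := by
  rw [cechSign_erase hj, cechSign_erase hl]
  rcases lt_or_gt_of_ne hjl with h | h
  · rw [if_pos h, if_neg h.not_gt]; ring
  · rw [if_pos h, if_neg h.not_gt]; ring

lemma cechD_cechD (f : Finset (Fin n) → M) : cechD (cechD f) = 0 := by
  funext σ
  simp only [cechD, Finset.smul_sum, smul_smul, Pi.zero_apply]
  rw [Finset.sum_sigma']
  refine Finset.sum_involution (fun x _ => ⟨x.2, x.1⟩) ?_ ?_ ?_ ?_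
  · rintro ⟨j, l⟩ h
    simp only [Finset.mem_sigma, Finset.mem_erase] at h
    obtain ⟨hj, hlj, hl⟩ := h
    simp only
    rw [cechSign_mul_erase hj hl hlj.symm, Finset.erase_right_comm, neg_smul, neg_add_cancel]
  · rintro ⟨j, l⟩ h _ heq
    simp only [Finset.mem_sigma, Finset.mem_erase] at h
    simp only [Sigma.mk.injEq] at heq
    exact h.2.1 heq.1
  · rintro ⟨j, l⟩ h
    simp only [Finset.mem_sigma, Finset.mem_erase] at h ⊢
    exact ⟨h.2.2, h.2.1.symm, h.1⟩
  · rintro ⟨j, l⟩ h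
    rfl

lemma cechD_cechH (a : Fin n) (f : Finset (Fin n) → M) (σ : Finset (Fin n)) :
    cechD (cechH a f) σ = f σ - cechH a (cechD f) σ := by
  rw [eq_sub_iff_add_eq]
  by_cases ha : a ∈ σ
  · have h1 : ∀ j ∈ σ, j ≠ a → cechSign j σ • cechH a f (σ.erase j) = 0 := fun j _ hja => by
      rw [cechH, if_pos (Finset.mem_erase.2 ⟨hja.symm, ha⟩), smul_zero]
    rw [cechD, Finset.sum_eq_single_of_mem a ha h1, cechH, cechH, if_pos ha, add_zero,
      if_neg (Finset.notMem_erase a σ), Finset.insert_erase ha, smul_smul,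
      cechSign_mul_self, one_smul]
  · rw [cechH, if_neg ha, cechD, cechD, Finset.sum_insert ha, smul_add, smul_smul,
      cechSign_mul_self, one_smul, Finset.erase_insert ha, add_left_comm, Finset.smul_sum,
      ← Finset.sum_add_distrib, Finset.sum_eq_zero, add_zero]
    intro j hj
    have hja : j ≠ a := fun h => ha (h ▸ hj)
    have h2 : (insert a σ).erase j = insert a (σ.erase j) := Finset.erase_insert_of_ne hja.symm
    have h3 := cechSign_mul_erase (Finset.mem_insert_self a σ)
      (Finset.mem_insert_of_mem hj) hja.symm
    rw [h2, Finset.erase_insert ha] at h3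
    have h4 := cechSign_mul_self j σ
    have h5 := cechSign_mul_self j (insert a σ)
    rw [cechH, if_neg (fun h => ha (Finset.mem_of_mem_erase h)), h2, smul_smul, smul_smul,
      ← add_smul]
    refine (congrArg (· • _) ?_).trans (zero_smul ℤ _)
    linear_combination (cechSign j (insert a σ) * cechSign j σ) * h3 -
      (cechSign a (insert a σ) * cechSign j (insert a σ)) * h4 -
      (cechSign j σ * cechSign a (insert a (σ.erase j))) * h5

lemma cechD_add (f g : Finset (Fin n) → M) : cechD (f + g) = cechD f + cechD g := by
  funext σ
  simp [cechD, Finset.sum_add_distrib]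

lemma cechD_sub (f g : Finset (Fin n) → M) : cechD (f - g) = cechD f - cechD g := by
  funext σ
  simp [cechD, smul_sub]

lemma cechD_comp (g : M →+ N) (f : Finset (Fin n) → M) (σ : Finset (Fin n)) :
    cechD (fun τ => g (f τ)) σ = g (cechD f σ) := by
  simp [cechD]

lemma cechD_congr {f g : Finset (Fin n) → M} {σ : Finset (Fin n)} (h : ∀ τ ⊆ σ, f τ = g τ) :
    cechD f σ = cechD g σ :=
  Finset.sum_congr rfl fun j _ => by rw [h _ (Finset.erase_subset j σ)]

lemma exists_of_cechD_ne_zero {f : Finset (Fin n) → M} {σ : Finset (Fin n)} (h : cechD f σ ≠ 0) :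
    ∃ j ∈ σ, f (σ.erase j) ≠ 0 := by
  obtain ⟨j, hj, h⟩ := Finset.exists_ne_zero_of_sum_ne_zero h
  exact ⟨j, hj, fun h0 => h (by rw [h0, smul_zero])⟩

lemma exists_of_cechH_ne_zero {a : Fin n} {f : Finset (Fin n) → M} {σ : Finset (Fin n)}
    (h : cechH a f σ ≠ 0) : a ∉ σ ∧ f (insert a σ) ≠ 0 := by
  rw [cechH] at h
  split_ifs at h with ha
  · exact absurd rfl h
  · exact ⟨ha, fun h0 => h (by rw [h0, smul_zero])⟩

lemma cechH_eq_zero {a : Fin n} {f : Finset (Fin n) → M} {σ : Finset (Fin n)}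
    (h : f (insert a σ) = 0) : cechH a f σ = 0 := by
  by_contra h'
  exact (exists_of_cechH_ne_zero h').2 h

end Cech

section Slice
variable {n : ℕ}

/-- The exponent `α` is nonnegative away from `σ`. -/
def NonnegOff (σ : Finset (Fin n)) (α : Fin n → ℤ) : Prop := ∀ j ∉ σ, 0 ≤ α j

/-- The face `σ` lies in a facet `F` such that the localization at the monomials supported on `σ`
of `P_F ^ 2` does not contain the Laurent monomial with exponent `α`. -/
def Good (Δ : Set (Finset (Fin n))) (σ : Finset (Fin n)) (α : Fin n → ℤ) : Prop :=
  ∃ F ∈ facets Δ, σ ⊆ F ∧ ∑ j ∈ Fᶜ, α j ≤ 1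

variable {Δ : Set (Finset (Fin n))} {σ τ : Finset (Fin n)} {α β : Fin n → ℤ}

lemma NonnegOff.mono (h : NonnegOff σ α) (hστ : σ ⊆ τ) : NonnegOff τ α :=
  fun j hj => h j fun h => hj (hστ h)

lemma NonnegOff.le (h : NonnegOff σ α) (hαβ : α ≤ β) : NonnegOff σ β :=
  fun j hj => (h j hj).trans (hαβ j)

lemma Good.anti (h : Good Δ τ α) (hστ : σ ⊆ τ) : Good Δ σ α := by
  obtain ⟨F, hF, hτ, hs⟩ := h
  exact ⟨F, hF, hστ.trans hτ, hs⟩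

lemma Good.le (h : Good Δ σ β) (hαβ : α ≤ β) : Good Δ σ α := by
  obtain ⟨F, hF, hσ, hs⟩ := h
  exact ⟨F, hF, hσ, (Finset.sum_le_sum fun j _ => hαβ j).trans hs⟩

variable {k : Type} [AddCommGroup k]

/-- A cocycle in degree `α` of the Čech complex, in cohomological degree `i`. -/
structure IsSliceCocycle (Δ : Set (Finset (Fin n))) (i : ℕ) (α : Fin n → ℤ)
    (s : Finset (Fin n) → k) : Prop where
  card_eq : ∀ σ, s σ ≠ 0 → σ.card = i
  nonneg : ∀ σ, s σ ≠ 0 → NonnegOff σ α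
  d_eq_zero : ∀ σ, Good Δ σ α → cechD s σ = 0

/-- A coboundary in degree `α` of the Čech complex, in cohomological degree `i`. -/
def IsSliceCoboundary (Δ : Set (Finset (Fin n))) (i : ℕ) (α : Fin n → ℤ)
    (s : Finset (Fin n) → k) : Prop :=
  ∃ w : Finset (Fin n) → k, (∀ σ, w σ ≠ 0 → σ.card + 1 = i ∧ NonnegOff σ α) ∧
    ∀ σ, Good Δ σ α → s σ = cechD w σ

variable {i : ℕ} {s : Finset (Fin n) → k}

lemma IsSliceCoboundary.zero : IsSliceCoboundary Δ i α (0 : Finset (Fin n) → k) :=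
  ⟨0, fun _ h => absurd rfl h, fun _ _ => by simp [cechD]⟩

lemma IsSliceCoboundary.le (h : IsSliceCoboundary Δ i α s) (hαβ : α ≤ β) :
    IsSliceCoboundary Δ i β s := by
  obtain ⟨w, hw, hs⟩ := h
  exact ⟨w, fun σ hσ => ⟨(hw σ hσ).1, (hw σ hσ).2.le hαβ⟩, fun σ hσ => hs σ (hσ.le hαβ)⟩

lemma IsSliceCocycle.le (h : IsSliceCocycle Δ i α s) (hαβ : α ≤ β) : IsSliceCocycle Δ i β s :=
  ⟨h.1, fun σ hσ => (h.2 σ hσ).le hαβ, fun σ hσ => h.3 σ (hσ.le hαβ)⟩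

lemma NonnegOff.of_cechD_ne_zero {w : Finset (Fin n) → k} (hw : ∀ σ, w σ ≠ 0 → NonnegOff σ α)
    (h : cechD w σ ≠ 0) : NonnegOff σ α := by
  obtain ⟨j, -, hj⟩ := exists_of_cechD_ne_zero h
  exact (hw _ hj).mono (Finset.erase_subset j σ)

lemma IsSliceCocycle.cechH_ne_zero (h : IsSliceCocycle Δ i α s) {a : Fin n} (ha : 0 ≤ α a)
    (hσ : cechH a s σ ≠ 0) : σ.card + 1 = i ∧ NonnegOff σ α := by
  obtain ⟨haσ, hs⟩ := exists_of_cechH_ne_zero hσ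
  refine ⟨by rw [← h.card_eq _ hs, Finset.card_insert_of_notMem haσ], fun j hj => ?_⟩
  by_cases hja : j = a
  · rwa [hja]
  · exact h.nonneg _ hs j (by simp [hja, hj])

lemma IsSliceCocycle.isSliceCoboundary_of_two_le (h : IsSliceCocycle Δ i α s) {a : Fin n}
    (ha : 2 ≤ α a) : IsSliceCoboundary Δ i α s := by
  have hw : ∀ σ, cechH a s σ ≠ 0 → σ.card + 1 = i ∧ NonnegOff σ α := fun σ =>
    h.cechH_ne_zero (by lia)
  refine ⟨cechH a s, hw, fun σ hσ => ?_⟩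
  by_cases hn : NonnegOff σ α
  · rw [cechD_cechH, cechH_eq_zero, sub_zero]
    refine h.d_eq_zero _ ?_
    obtain ⟨F, hF, hσF, hs⟩ := hσ
    refine ⟨F, hF, Finset.insert_subset ?_ hσF, hs⟩
    by_contra haF
    have := Finset.single_le_sum (f := α) (s := Fᶜ) (fun j hj => hn j fun h =>
      (Finset.mem_compl.1 hj) (hσF h)) (Finset.mem_compl.2 haF)
    lia
  · have h1 : s σ = 0 := by
      by_contra h'
      exact hn (h.nonneg σ h')
    have h2 : cechD (cechH a s) σ = 0 := by
      by_contra h'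
      exact hn (.of_cechD_ne_zero (fun σ hσ => (hw σ hσ).2) h')
    rw [h1, h2]

lemma exists_facet_of_mem {G : SimpleGraph (Fin n)} (hσ : σ ∈ indepComplex G) :
    ∃ F ∈ facets (indepComplex G), σ ⊆ F := by
  obtain ⟨F, hσF, hF⟩ := Set.Finite.exists_le_maximal (Set.toFinite (indepComplex G)) hσ
  exact ⟨F, ⟨hF.1, fun H hH hFH => le_antisymm hFH (hF.2 hH hFH)⟩, hσF⟩

/-- The faces lying in a facet that contains `T` and is admissible for `α`. -/
def GoodAt (Δ : Set (Finset (Fin n))) (T σ : Finset (Fin n)) (α : Fin n → ℤ) : Prop :=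
  ∃ F ∈ facets Δ, σ ⊆ F ∧ T ⊆ F ∧ ∑ j ∈ Fᶜ, α j ≤ 1

lemma GoodAt.anti {T T' : Finset (Fin n)} (h : GoodAt Δ T τ α) (hστ : σ ⊆ τ) (hT : T' ⊆ T) :
    GoodAt Δ T' σ α := by
  obtain ⟨F, hF, hτ, hs, hs'⟩ := h
  exact ⟨F, hF, hστ.trans hτ, hT.trans hs, hs'⟩

lemma GoodAt.good_insert {T : Finset (Fin n)} {a : Fin n} (h : GoodAt Δ T σ α) (ha : a ∈ T) :
    Good Δ (insert a σ) α := by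
  obtain ⟨F, hF, hτ, hs, hs'⟩ := h
  exact ⟨F, hF, Finset.insert_subset (hs ha) hτ, hs'⟩

lemma eq_zero_of_sum_compl_le_one {F : Finset (Fin n)} (hα : 0 ≤ α) (hF : ∑ j ∈ Fᶜ, α j ≤ 1)
    {a b : Fin n} (ha : 1 ≤ α a) (haF : a ∉ F) (hbF : b ∉ F) (hab : a ≠ b) : α b = 0 := by
  have h1 := Finset.sum_le_sum_of_subset_of_nonneg (f := α) (s := {a, b}) (t := Fᶜ) (by
    intro x hx
    simp only [Finset.mem_insert, Finset.mem_singleton] at hx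
    rcases hx with rfl | rfl <;> simpa) (fun j _ _ => hα j)
  rw [Finset.sum_pair hab] at h1
  have := hα b
  simp only [Pi.zero_apply] at this
  lia

variable {G : SimpleGraph (Fin n)} {a b : Fin n}

lemma Good.goodAt_or (hα : 0 ≤ α) (ha : 1 ≤ α a) (hb : 1 ≤ α b) (hab : a ≠ b)
    (h : Good Δ σ α) : GoodAt Δ {a} σ α ∨ GoodAt Δ {b} σ α := by
  obtain ⟨F, hF, hσF, hs⟩ := h
  by_cases haF : a ∈ F
  · exact .inl ⟨F, hF, hσF, by simpa, hs⟩
  · refine .inr ⟨F, hF, hσF, ?_, hs⟩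
    by_contra hbF
    have := eq_zero_of_sum_compl_le_one hα hs ha haF (by simpa using hbF) hab
    lia

lemma GoodAt.pair (hα : 0 ≤ α) (ha : 1 ≤ α a) (hb : 1 ≤ α b) (hab : a ≠ b) (hG : ¬ G.Adj a b)
    (h : GoodAt (indepComplex G) {a} σ α) (h' : GoodAt (indepComplex G) {b} σ α) :
    GoodAt (indepComplex G) {a, b} σ α := by
  obtain ⟨F, hF, hσF, haF, hs⟩ := h
  obtain ⟨F', hF', hσF', hbF', hs'⟩ := h'
  rw [Finset.singleton_subset_iff] at haF hbF'
  by_cases hbF : b ∈ F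
  · exact ⟨F, hF, hσF, by simp [Finset.insert_subset_iff, *], hs⟩
  by_cases haF' : a ∈ F'
  · exact ⟨F', hF', hσF', by simp [Finset.insert_subset_iff, *], hs'⟩
  let U : Finset (Fin n) := σ ∪ Finset.univ.filter (fun j => α j ≠ 0)
  have h1 : ∀ j ∈ U, j ≠ b → j ∈ F := by
    intro j hj hjb
    by_contra hjF
    have := eq_zero_of_sum_compl_le_one hα hs hb hbF hjF hjb.symm
    simp only [U, Finset.mem_union, Finset.mem_filter, Finset.mem_univ, true_and] at hj
    exact hj.elim (fun h => hjF (hσF h)) (fun h => h this)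
  have h2 : ∀ j ∈ U, j ≠ a → j ∈ F' := by
    intro j hj hja
    by_contra hjF
    have := eq_zero_of_sum_compl_le_one hα hs' ha haF' hjF hja.symm
    simp only [U, Finset.mem_union, Finset.mem_filter, Finset.mem_univ, true_and] at hj
    exact hj.elim (fun h => hjF (hσF' h)) (fun h => h this)
  have hU : U ∈ indepComplex G := by
    intro x hx y hy hxy
    by_cases hxb : x = b
    · subst hxb
      by_cases hya : y = a
      · exact hG (hya ▸ hxy.symm)
      · exact hF'.1 _ hbF' _ (h2 y hy hya) hxy
    · by_cases hyb : y = b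
      · subst hyb
        by_cases hxa : x = a
        · exact hG (hxa ▸ hxy)
        · exact hF'.1 _ (h2 x hx hxa) _ hbF' hxy
      · exact hF.1 _ (h1 x hx hxb) _ (h1 y hy hyb) hxy
  obtain ⟨F'', hF'', hUF⟩ := exists_facet_of_mem hU
  have h3 : ∀ j, α j ≠ 0 → j ∈ F'' := fun j hj => hUF (by simp [U, hj])
  refine ⟨F'', hF'', (Finset.subset_union_left).trans hUF, ?_, ?_⟩
  · intro j hj
    simp only [Finset.mem_insert, Finset.mem_singleton] at hj
    rcases hj with rfl | rfl
    · exact h3 _ (by lia)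
    · exact h3 _ (by lia)
  · rw [Finset.sum_eq_zero fun j hj => ?_]
    · exact zero_le_one
    · by_contra h
      exact (Finset.mem_compl.1 hj) (h3 j h)

open Classical in
lemma IsSliceCocycle.isSliceCoboundary_of_not_adj (h : IsSliceCocycle (indepComplex G) i α s)
    (hα : 0 ≤ α) (ha : 1 ≤ α a) (hb : 1 ≤ α b) (hab : a ≠ b) (hG : ¬ G.Adj a b) :
    IsSliceCoboundary (indepComplex G) i α s := by
  have hd (c : Fin n) {T : Finset (Fin n)} (hc : c ∈ T) {σ} (hσ : GoodAt (indepComplex G) T σ α) :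
      cechD (cechH c s) σ = s σ := by
    rw [cechD_cechH, cechH_eq_zero (h.d_eq_zero _ (hσ.good_insert hc)), sub_zero]
  let u := cechH a s - cechH b s
  let v : Finset (Fin n) → k := fun σ =>
    if GoodAt (indepComplex G) {a, b} σ α then cechH a u σ else 0
  have hv : ∀ σ, GoodAt (indepComplex G) {a, b} σ α → cechD v σ = u σ := by
    intro σ hσ
    have h1 : cechD v σ = cechD (cechH a u) σ :=
      cechD_congr fun τ hτ => if_pos (hσ.anti hτ le_rfl)
    rw [h1, cechD_cechH, cechH_eq_zero, sub_zero]
    have h2 : GoodAt (indepComplex G) {a, b} (insert a σ) α := by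
      obtain ⟨F, hF, h1, h2, h3⟩ := hσ
      exact ⟨F, hF, Finset.insert_subset (h2 (by simp)) h1, h2, h3⟩
    rw [cechD_sub, Pi.sub_apply, hd a (by simp) h2, hd b (by simp) h2, sub_self]
  have hcard (c : Fin n) (σ) (hσ : cechH c s σ ≠ 0) : σ.card + 1 = i :=
    (h.cechH_ne_zero (hα c) hσ).1
  have hvcard (σ) (hσ : v σ ≠ 0) : σ.card + 1 + 1 = i := by
    have h1 : cechH a u σ ≠ 0 := by
      intro h0
      refine hσ ?_
      simp only [v, h0, ite_self]
    obtain ⟨haσ, h2⟩ := exists_of_cechH_ne_zero h1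
    rw [← Finset.card_insert_of_notMem haσ]
    by_cases h3 : cechH a s (insert a σ) = 0
    · refine hcard b _ fun h4 => h2 ?_
      simp only [u, Pi.sub_apply, h3, h4, sub_self]
    · exact hcard a _ h3
  let w : Finset (Fin n) → k := fun σ =>
    if GoodAt (indepComplex G) {a} σ α then cechH a s σ else cechH b s σ + cechD v σ
  refine ⟨w, fun σ hσ => ⟨?_, fun j _ => hα j⟩, fun σ hσ => ?_⟩
  · simp only [w] at hσ
    split_ifs at hσ
    · exact hcard a σ hσ
    · by_cases h1 : cechH b s σ = 0
      · rw [h1, zero_add] at hσ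
        obtain ⟨j, hj, hj'⟩ := exists_of_cechD_ne_zero hσ
        rw [← hvcard _ hj', Finset.card_erase_add_one hj]
      · exact hcard b σ h1
  · by_cases h1 : GoodAt (indepComplex G) {a} σ α
    · rw [← hd a (by simp) h1]
      exact cechD_congr fun τ hτ => (if_pos (h1.anti hτ le_rfl)).symm
    · have h2 := (hσ.goodAt_or hα ha hb hab).resolve_left h1
      have h3 : cechD w σ = cechD (cechH b s + cechD v) σ := by
        refine cechD_congr fun τ hτ => ?_
        by_cases h4 : GoodAt (indepComplex G) {a} τ α
        · refine (if_pos h4).trans ?_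
          rw [Pi.add_apply, hv τ (h4.pair hα ha hb hab hG (h2.anti hτ le_rfl))]
          simp [u]
        · exact if_neg h4
      rw [h3, cechD_add, cechD_cechD, add_zero, hd b (by simp) h2]

lemma not_good_of_triangle {c : Fin n} (hα : 0 ≤ α) (ha : 1 ≤ α a) (hb : 1 ≤ α b) (hc : 1 ≤ α c)
    (hab : G.Adj a b) (hac : G.Adj a c) (hbc : G.Adj b c) : ¬ Good (indepComplex G) σ α := by
  rintro ⟨F, hF, -, hs⟩
  have key {x y : Fin n} (hx : 1 ≤ α x) (hy : 1 ≤ α y) (hxy : x ≠ y) (hxF : x ∉ F) (hyF : y ∉ F) :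
      False := by
    have := eq_zero_of_sum_compl_le_one hα hs hx hxF hyF hxy
    lia
  have h1 := hF.1
  by_cases haF : a ∈ F
  · exact key hb hc hbc.ne (fun h => h1 _ haF _ h hab) (fun h => h1 _ haF _ h hac)
  · by_cases hbF : b ∈ F
    · exact key ha hc hac.ne haF (fun h => h1 _ hbF _ h hbc)
    · exact key ha hb hab.ne haF hbF

lemma IsSliceCocycle.isSliceCoboundary_of_three {c : Fin n}
    (h : IsSliceCocycle (indepComplex G) i α s)
    (hα : 0 ≤ α) (hβ : β = α + Pi.single a 1 + Pi.single b 1 + Pi.single c 1) :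
    IsSliceCoboundary (indepComplex G) i β s := by
  have hsingle (x : Fin n) : (0 : Fin n → ℤ) ≤ Pi.single x 1 := Pi.single_nonneg.2 zero_le_one
  have hle : α ≤ β := by
    rw [hβ, add_assoc, add_assoc]
    exact le_add_of_nonneg_right (add_nonneg (hsingle a) (add_nonneg (hsingle b) (hsingle c)))
  have h' := h.le hle
  have hβ0 := hα.trans hle
  have hva (x : Fin n) : β x = α x + (Pi.single a 1 : Fin n → ℤ) x + (Pi.single b 1 : Fin n → ℤ) x +
    (Pi.single c 1 : Fin n → ℤ) x := by rw [hβ]; rfl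
  have h0 (x y : Fin n) : 0 ≤ (Pi.single y 1 : Fin n → ℤ) x := hsingle y x
  have hα' (x : Fin n) : 0 ≤ α x := hα x
  have h1 (x : Fin n) : (Pi.single x 1 : Fin n → ℤ) x = 1 := Pi.single_eq_same x 1
  have ha : 1 ≤ β a := by
    have := hva a; have := h0 a b; have := h0 a c; have := h1 a; have := hα' a
    lia
  have hb : 1 ≤ β b := by
    have := hva b; have := h0 b a; have := h0 b c; have := h1 b; have := hα' b
    lia
  have hc : 1 ≤ β c := by
    have := hva c; have := h0 c b; have := h0 c a; have := h1 c; have := hα' c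
    lia
  by_cases hab : a = b
  · subst hab
    exact h'.isSliceCoboundary_of_two_le (a := a) (by
      have := hva a; have := h0 a c; have := h1 a; have := hα' a; lia)
  by_cases hac : a = c
  · subst hac
    exact h'.isSliceCoboundary_of_two_le (a := a) (by
      have := hva a; have := h0 a b; have := h1 a; have := hα' a; lia)
  by_cases hbc : b = c
  · subst hbc
    exact h'.isSliceCoboundary_of_two_le (a := b) (by
      have := hva b; have := h0 b a; have := h1 b; have := hα' b; lia)
  by_cases hab' : G.Adj a b
  · by_cases hac' : G.Adj a c
    · by_cases hbc' : G.Adj b c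
      · exact ⟨0, fun _ h => absurd rfl h, fun σ hσ =>
          absurd hσ (not_good_of_triangle hβ0 ha hb hc hab' hac' hbc')⟩
      · exact h'.isSliceCoboundary_of_not_adj hβ0 hb hc hbc hbc'
    · exact h'.isSliceCoboundary_of_not_adj hβ0 ha hc hac hac'
  · exact h'.isSliceCoboundary_of_not_adj hβ0 ha hb hab hab'

lemma IsSliceCocycle.sub_single_of_neg (h : IsSliceCocycle Δ i α s) {j : Fin n} (hj : α j < 0)
    (N : ℤ) : IsSliceCocycle Δ i (α - Pi.single j N) s := by
  have hmem {σ} (hσ : NonnegOff σ α) : j ∈ σ := by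
    by_contra hj'
    exact absurd (hσ j hj') (not_le.2 hj)
  have hval {x : Fin n} (hx : x ≠ j) : (α - Pi.single j N : Fin n → ℤ) x = α x := by simp [hx]
  refine ⟨h.1, fun σ hσ x hx => ?_, fun σ hσ => ?_⟩
  · rw [hval (by rintro rfl; exact hx (hmem (h.nonneg σ hσ)))]
    exact h.nonneg σ hσ x hx
  · by_contra h0
    have hjσ := hmem (NonnegOff.of_cechD_ne_zero h.nonneg h0)
    obtain ⟨F, hF, hσF, hs⟩ := hσ
    refine h0 (h.d_eq_zero σ ⟨F, hF, hσF, ?_⟩)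
    rwa [Finset.sum_congr rfl fun x hx => ?_] at hs
    exact hval fun hxj => (Finset.mem_compl.1 hx) (hxj ▸ hσF hjσ)

end Slice

noncomputable section
variable {n : ℕ} {k : Type} [Field k]

variable (n k) in
/-- The ring of Laurent polynomials in `n` variables. -/
def Laurent : Type := AddMonoidAlgebra k (Fin n → ℤ)

namespace Laurent

instance : CommRing (Laurent n k) := inferInstanceAs (CommRing (AddMonoidAlgebra k (Fin n → ℤ)))

/-- The integral vector of a monomial exponent. -/
def expHom : (Fin n →₀ ℕ) →+ (Fin n → ℤ) where
  toFun β j := β j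
  map_zero' := by ext; simp
  map_add' _ _ := by ext; simp

lemma expHom_injective : Function.Injective (expHom (n := n)) := fun _ _ h =>
  Finsupp.ext fun j => Int.ofNat_inj.1 (congrFun h j)

lemma expHom_single (j : Fin n) (N : ℕ) : expHom (Finsupp.single j N) = Pi.single j (N : ℤ) := by
  ext l
  by_cases h : l = j
  · subst h; simp [expHom]
  · simp [expHom, h, Finsupp.single_eq_of_ne h]

/-- The inclusion of polynomials in Laurent polynomials. -/
def ofPolynomial : MvPolynomial (Fin n) k →+* Laurent n k :=
  AddMonoidAlgebra.mapDomainRingHom k expHom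

instance : Algebra (MvPolynomial (Fin n) k) (Laurent n k) := ofPolynomial.toAlgebra

lemma smul_def (p : MvPolynomial (Fin n) k) (f : Laurent n k) : p • f = ofPolynomial p * f := rfl

/-- The coefficient of a Laurent polynomial. -/
def coeff (α : Fin n → ℤ) : Laurent n k →+ k :=
  (Finsupp.applyAddHom α).comp AddMonoidAlgebra.coeffAddEquiv.toAddMonoidHom

@[ext] lemma ext {f g : Laurent n k} (h : ∀ α, coeff α f = coeff α g) : f = g :=
  AddMonoidAlgebra.ext (Finsupp.ext h)

/-- A Laurent monomial. -/
def mono (α : Fin n → ℤ) (c : k) : Laurent n k := AddMonoidAlgebra.single α c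

lemma coeff_mono (α β : Fin n → ℤ) (c : k) : coeff β (mono α c) = if α = β then c else 0 := by
  classical
  exact Finsupp.single_apply

lemma coeff_mono_mul (α β : Fin n → ℤ) (c : k) (f : Laurent n k) :
    coeff α (mono β c * f) = c * coeff (α - β) f := by
  rw [sub_eq_neg_add]
  exact AddMonoidAlgebra.coeff_single_mul_apply f c β α

lemma finite_support (f : Laurent n k) : {α | coeff α f ≠ 0}.Finite :=
  Finsupp.hasFiniteSupport (AddMonoidAlgebra.coeff f)

lemma ofPolynomial_monomial (β : Fin n →₀ ℕ) (c : k) :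
    ofPolynomial (monomial β c) = mono (expHom β) c :=
  AddMonoidAlgebra.mapDomain_single

lemma coeff_ofPolynomial (β : Fin n →₀ ℕ) (p : MvPolynomial (Fin n) k) :
    coeff (expHom β) (ofPolynomial p) = p.coeff β :=
  Finsupp.mapDomain_apply expHom_injective _ _

lemma exists_of_coeff_ofPolynomial_ne_zero {α : Fin n → ℤ} {p : MvPolynomial (Fin n) k}
    (h : coeff α (ofPolynomial p) ≠ 0) : ∃ β ∈ p.support, expHom β = α := by
  classical
  obtain ⟨β, hβ, h⟩ := Finset.mem_image.1 (Finsupp.mapDomain_support (Finsupp.mem_support_iff.2 h))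
  exact ⟨β, hβ, h⟩

lemma coeff_X_pow_smul (j : Fin n) (N : ℕ) (α : Fin n → ℤ) (f : Laurent n k) :
    coeff α ((X j ^ N : MvPolynomial (Fin n) k) • f) = coeff (α - Pi.single j (N : ℤ)) f := by
  rw [smul_def, X_pow_eq_monomial, ofPolynomial_monomial, coeff_mono_mul, one_mul, expHom_single]

lemma coeff_X_smul (j : Fin n) (α : Fin n → ℤ) (f : Laurent n k) :
    coeff α ((X j : MvPolynomial (Fin n) k) • f) = coeff (α - Pi.single j 1) f := by
  have := coeff_X_pow_smul j 1 α f
  rwa [pow_one] at this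

lemma coeff_C_smul (c : k) (α : Fin n → ℤ) (f : Laurent n k) :
    coeff α ((C c : MvPolynomial (Fin n) k) • f) = c * coeff α f := by
  rw [smul_def, C_apply, ofPolynomial_monomial, coeff_mono_mul, map_zero, sub_zero]

/-- Multiplication by a Laurent monomial. -/
def shift (β : Fin n → ℤ) : Laurent n k →ₗ[MvPolynomial (Fin n) k] Laurent n k :=
  LinearMap.mulLeft _ (mono β 1)

lemma coeff_shift (α β : Fin n → ℤ) (f : Laurent n k) :
    coeff α (shift β f) = coeff (α - β) f := by
  rw [shift, LinearMap.mulLeft_apply, coeff_mono_mul, one_mul]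

lemma X_pow_smul_shift (j : Fin n) (N : ℕ) (f : Laurent n k) :
    (X j ^ N : MvPolynomial (Fin n) k) • shift (-Pi.single j (N : ℤ)) f = f := by
  ext α
  rw [coeff_X_pow_smul, coeff_shift, sub_neg_eq_add, sub_add_cancel]

end Laurent

variable (n k) in
/-- The full Čech complex of the Laurent polynomials. -/
abbrev CechModule : Type := Finset (Fin n) → Laurent n k

namespace CechModule
open Laurent

/-- The part of a Čech cochain in degree `α`. -/
def slice (f : CechModule n k) (α : Fin n → ℤ) : Finset (Fin n) → k := fun σ => coeff α (f σ)

lemma ext_slice {f g : CechModule n k} (h : ∀ α, slice f α = slice g α) : f = g :=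
  funext fun σ => Laurent.ext fun α => congrFun (h α) σ

/-- The Čech differential as a linear map. -/
def dL : CechModule n k →ₗ[MvPolynomial (Fin n) k] CechModule n k where
  toFun := cechD
  map_add' := cechD_add
  map_smul' r f := funext fun σ => cechD_comp (DistribSMul.toAddMonoidHom _ r) f σ

lemma slice_dL (f : CechModule n k) (α : Fin n → ℤ) : slice (dL f) α = cechD (slice f α) :=
  funext fun σ => (cechD_comp (coeff α) f σ).symm

/-- The submodule of cochains with restricted support. -/
def restrictSupport (P : Finset (Fin n) → (Fin n → ℤ) → Prop)
    (hP : ∀ σ α j, P σ α → P σ (α + Pi.single j 1)) :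
    Submodule (MvPolynomial (Fin n) k) (CechModule n k) where
  carrier := {f | ∀ σ α, coeff α (f σ) ≠ 0 → P σ α}
  zero_mem' σ α h := absurd (map_zero _) h
  add_mem' := by
    intro f g hf hg σ α h
    by_cases h1 : coeff α (f σ) = 0
    · refine hg σ α fun h2 => h ?_
      rw [Pi.add_apply, map_add, h1, h2, add_zero]
    · exact hf σ α h1
  smul_mem' := by
    intro p
    induction p using MvPolynomial.induction_on with
    | C c =>
      intro f hf σ α h
      refine hf σ α fun h1 => h ?_
      rw [Pi.smul_apply, coeff_C_smul, h1, mul_zero]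
    | add p q hp hq =>
      intro f hf σ α h
      by_cases h1 : coeff α ((p • f) σ) = 0
      · refine hq hf σ α fun h2 => h ?_
        rw [add_smul, Pi.add_apply, map_add, h1, h2, add_zero]
      · exact hp hf σ α h1
    | mul_X p j hp =>
      intro f hf
      rw [mul_smul]
      refine hp fun σ α h => ?_
      rw [Pi.smul_apply, coeff_X_smul] at h
      simpa using hP σ _ j (hf σ _ h)

end CechModule
end

noncomputable section
variable {n : ℕ} {k : Type} [Field k]

namespace CechModule
open Laurent

lemma NonnegOff.add_single {σ : Finset (Fin n)} {α : Fin n → ℤ} (h : NonnegOff σ α) (j : Fin n) :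
    NonnegOff σ (α + Pi.single j 1) :=
  h.le (le_add_of_nonneg_right (Pi.single_nonneg.2 zero_le_one))

lemma not_good_add_single {Δ : Set (Finset (Fin n))} {σ : Finset (Fin n)} {α : Fin n → ℤ}
    (h : ¬ Good Δ σ α) (j : Fin n) : ¬ Good Δ σ (α + Pi.single j 1) :=
  fun h' => h (h'.le (le_add_of_nonneg_right (Pi.single_nonneg.2 zero_le_one)))

variable (n k) in
/-- The Čech cochains of degree `i` of the polynomial ring. -/
def cochains (i : ℕ) : Submodule (MvPolynomial (Fin n) k) (CechModule n k) :=
  restrictSupport (fun σ α => σ.card = i ∧ NonnegOff σ α)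
    fun _ _ j h => ⟨h.1, NonnegOff.add_single h.2 j⟩

variable (n k) in
/-- The Čech cochains of degree `i - 1` of the polynomial ring. -/
def precochains (i : ℕ) : Submodule (MvPolynomial (Fin n) k) (CechModule n k) :=
  restrictSupport (fun σ α => σ.card + 1 = i ∧ NonnegOff σ α)
    fun _ _ j h => ⟨h.1, NonnegOff.add_single h.2 j⟩

variable (k) in
/-- The cochains with coefficients in the localizations of the second symbolic power. -/
def bad (Δ : Set (Finset (Fin n))) : Submodule (MvPolynomial (Fin n) k) (CechModule n k) :=
  restrictSupport (fun σ α => ¬ Good Δ σ α) fun _ _ j h => not_good_add_single h j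

lemma mem_cochains {i : ℕ} {f : CechModule n k} :
    f ∈ cochains n k i ↔ ∀ σ α, coeff α (f σ) ≠ 0 → σ.card = i ∧ NonnegOff σ α := Iff.rfl

lemma mem_precochains {i : ℕ} {f : CechModule n k} :
    f ∈ precochains n k i ↔ ∀ σ α, coeff α (f σ) ≠ 0 → σ.card + 1 = i ∧ NonnegOff σ α := Iff.rfl

lemma precochains_succ (i : ℕ) : precochains n k (i + 1) = cochains n k i := by
  ext f
  simp [mem_precochains, mem_cochains]

lemma precochains_zero : precochains n k 0 = ⊥ := by
  refine eq_bot_iff.2 fun f hf => ?_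
  rw [Submodule.mem_bot]
  refine ext_slice fun α => funext fun σ => ?_
  by_contra h
  exact absurd (hf σ α h).1 (Nat.succ_ne_zero _)

lemma exists_of_coeff_dL_ne_zero {f : CechModule n k} {σ : Finset (Fin n)} {α : Fin n → ℤ}
    (h : coeff α (dL f σ) ≠ 0) : ∃ j ∈ σ, coeff α (f (σ.erase j)) ≠ 0 := by
  have h' : cechD (slice f α) σ ≠ 0 := by rwa [← slice_dL]
  exact exists_of_cechD_ne_zero h'

lemma cochains_le_comap_dL (i : ℕ) : cochains n k i ≤ (cochains n k (i + 1)).comap dL := by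
  intro f hf σ α h
  obtain ⟨j, hj, h⟩ := exists_of_coeff_dL_ne_zero h
  obtain ⟨h1, h2⟩ := hf _ _ h
  exact ⟨by rw [← h1, Finset.card_erase_add_one hj], h2.mono (Finset.erase_subset j σ)⟩

lemma bad_le_comap_dL (Δ : Set (Finset (Fin n))) : bad k Δ ≤ (bad k Δ).comap dL := by
  intro f hf σ α h h'
  obtain ⟨j, hj, h⟩ := exists_of_coeff_dL_ne_zero h
  exact hf _ _ h (h'.anti (Finset.erase_subset j σ))

lemma dL_dL (f : CechModule n k) : dL (dL f) = 0 := cechD_cechD f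

variable (k) in
/-- The Čech complex of the quotient by the second symbolic power. -/
abbrev Cech (Δ : Set (Finset (Fin n))) (i : ℕ) : Type :=
  cochains n k i ⧸ (bad k Δ).submoduleOf (cochains n k i)

/-- The map on Čech complexes of quotients induced by an endomorphism. -/
def Cech.map (Δ : Set (Finset (Fin n))) {i i' : ℕ}
    (L : CechModule n k →ₗ[MvPolynomial (Fin n) k] CechModule n k)
    (hL : cochains n k i ≤ (cochains n k i').comap L) (hL' : bad k Δ ≤ (bad k Δ).comap L) :
    Cech k Δ i →ₗ[MvPolynomial (Fin n) k] Cech k Δ i' :=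
  Submodule.mapQ _ _ (L.restrict hL) fun _ hx => hL' hx

/-- The differential of the Čech complex of a quotient. -/
def Cech.d (Δ : Set (Finset (Fin n))) (i : ℕ) :
    Cech k Δ i →ₗ[MvPolynomial (Fin n) k] Cech k Δ (i + 1) :=
  Cech.map Δ dL (cochains_le_comap_dL i) (bad_le_comap_dL Δ)

variable {Δ : Set (Finset (Fin n))} {i : ℕ}

/-- The class of a cochain. -/
def Cech.mk (Δ : Set (Finset (Fin n))) {i : ℕ} :
    cochains n k i →ₗ[MvPolynomial (Fin n) k] Cech k Δ i :=
  Submodule.mkQ _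

lemma Cech.mk_surjective : Function.Surjective (Cech.mk Δ : cochains n k i →ₗ[_] Cech k Δ i) :=
  Submodule.mkQ_surjective _

lemma Cech.mk_eq_zero (z : cochains n k i) : Cech.mk Δ z = 0 ↔ (z : CechModule n k) ∈ bad k Δ :=
  Submodule.Quotient.mk_eq_zero _

lemma Cech.d_mk (z : cochains n k i) :
    Cech.d Δ i (Cech.mk Δ z) = Cech.mk Δ ⟨dL z, cochains_le_comap_dL i z.2⟩ := rfl

lemma Cech.d_d (i : ℕ) (z : Cech k Δ i) : Cech.d Δ (i + 1) (Cech.d Δ i z) = 0 := by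
  obtain ⟨z, rfl⟩ := Cech.mk_surjective z
  rw [Cech.d_mk, Cech.d_mk, Cech.mk_eq_zero]
  exact (congrArg (· ∈ bad k Δ) (dL_dL (z : CechModule n k))).mpr (zero_mem _)

variable (k) in
/-- Cochains that are coboundaries modulo the symbolic power. -/
def cob (Δ : Set (Finset (Fin n))) (i : ℕ) : Submodule (MvPolynomial (Fin n) k) (CechModule n k) :=
  (precochains n k i).map dL ⊔ bad k Δ

lemma Cech.mk_mem_coboundaries (z : cochains n k i) :
    Cech.mk Δ z ∈ coboundaries (Cech.d Δ) i ↔ (z : CechModule n k) ∈ cob k Δ i := by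
  cases i with
  | zero =>
    rw [cob, precochains_zero, Submodule.map_bot, bot_sup_eq, ← Cech.mk_eq_zero]
    exact Submodule.mem_bot _
  | succ i =>
    rw [cob, precochains_succ, Submodule.mem_sup]
    constructor
    · rintro ⟨w, hw⟩
      obtain ⟨w, rfl⟩ := Cech.mk_surjective w
      rw [Cech.d_mk, ← sub_eq_zero, ← map_sub, Cech.mk_eq_zero] at hw
      refine ⟨dL w, ⟨w, w.2, rfl⟩, _, neg_mem hw, ?_⟩
      simp
    · rintro ⟨_, ⟨w, hw, rfl⟩, b, hb, h⟩
      refine ⟨Cech.mk Δ ⟨w, hw⟩, ?_⟩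
      rw [Cech.d_mk, ← sub_eq_zero, ← map_sub, Cech.mk_eq_zero]
      have : dL w - z = -b := by rw [← h]; abel
      simpa [this] using hb

/-- The Čech cochains concentrated in degree `α`. -/
def ofSlice (α : Fin n → ℤ) (s : Finset (Fin n) → k) : CechModule n k := fun σ => mono α (s σ)

lemma coeff_ofSlice (α β : Fin n → ℤ) (s : Finset (Fin n) → k) (σ : Finset (Fin n)) :
    coeff β (ofSlice α s σ) = if α = β then s σ else 0 :=
  coeff_mono _ _ _

lemma slice_ofSlice_self (α : Fin n → ℤ) (s : Finset (Fin n) → k) : slice (ofSlice α s) α = s :=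
  funext fun σ => (coeff_ofSlice α α s σ).trans (if_pos rfl)

lemma slice_ofSlice_ne {α β : Fin n → ℤ} (h : α ≠ β) (s : Finset (Fin n) → k) :
    slice (ofSlice α s) β = 0 :=
  funext fun σ => (coeff_ofSlice α β s σ).trans (if_neg h)

lemma slice_sum {ι : Type} (t : Finset ι) (f : ι → CechModule n k) (α : Fin n → ℤ) :
    slice (∑ l ∈ t, f l) α = ∑ l ∈ t, slice (f l) α := by
  funext σ
  simp [slice]

lemma finite_slice (f : CechModule n k) : {α | slice f α ≠ 0}.Finite := by
  refine (Set.finite_iUnion fun σ => finite_support (f σ)).subset fun α h => ?_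
  obtain ⟨σ, hσ⟩ := Function.ne_iff.1 h
  exact Set.mem_iUnion.2 ⟨σ, hσ⟩

lemma isSliceCocycle_slice {z : CechModule n k} (hz : z ∈ cochains n k i) (hz' : dL z ∈ bad k Δ)
    (α : Fin n → ℤ) : IsSliceCocycle Δ i α (slice z α) where
  card_eq σ h := (hz σ α h).1
  nonneg σ h := (hz σ α h).2
  d_eq_zero σ h := by
    rw [← slice_dL]
    by_contra h'
    exact hz' σ α h' h

lemma ofSlice_mem {α : Fin n → ℤ} {s : Finset (Fin n) → k} (h : IsSliceCocycle Δ i α s) :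
    ofSlice α s ∈ cochains n k i ∧ dL (ofSlice α s) ∈ bad k Δ := by
  constructor
  · intro σ β hβ
    rw [coeff_ofSlice] at hβ
    split_ifs at hβ with hαβ
    · exact hαβ ▸ ⟨h.card_eq σ hβ, h.nonneg σ hβ⟩
    · exact absurd rfl hβ
  · intro σ β hβ hg
    refine hβ ?_
    refine (congrFun (slice_dL (ofSlice α s) β) σ).trans ?_
    by_cases hαβ : α = β
    · subst hαβ
      rw [slice_ofSlice_self, h.d_eq_zero σ hg]
    · rw [slice_ofSlice_ne hαβ]
      simp [cechD]

lemma mem_cob_iff {z : CechModule n k} :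
    z ∈ cob k Δ i ↔ ∀ α, IsSliceCoboundary Δ i α (slice z α) := by
  classical
  constructor
  · intro hz α
    obtain ⟨_, ⟨w, hw, rfl⟩, b, hb, rfl⟩ := Submodule.mem_sup.1 hz
    refine ⟨slice w α, fun σ => hw σ α, fun σ hσ => ?_⟩
    have hb' : coeff α (b σ) = 0 := by
      by_contra h
      exact hb σ α h hσ
    rw [← slice_dL, slice, slice, Pi.add_apply, map_add, hb', add_zero]
  · intro h
    choose w hw hw' using h
    let W : CechModule n k := ∑ α ∈ (finite_slice z).toFinset, ofSlice α (w α)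
    have hW (α) : slice W α = if slice z α = 0 then 0 else w α := by
      rw [slice_sum]
      by_cases hα : slice z α = 0
      · rw [if_pos hα]
        refine Finset.sum_eq_zero fun β hβ => slice_ofSlice_ne ?_ _
        rintro rfl
        simp [hα] at hβ
      · rw [if_neg hα, Finset.sum_eq_single_of_mem α (by simpa using hα), slice_ofSlice_self]
        exact fun β _ hβ => slice_ofSlice_ne hβ _
    refine Submodule.mem_sup.2 ⟨dL W, ⟨W, fun σ α h => ?_, rfl⟩, z - dL W, fun σ α h hg => h ?_,
      add_sub_cancel _ _⟩
    · have h1 : slice W α σ ≠ 0 := h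
      rw [hW] at h1
      split_ifs at h1
      · exact absurd rfl h1
      · exact hw α σ h1
    · have h1 : coeff α (dL W σ) = cechD (slice W α) σ := congrFun (slice_dL W α) σ
      rw [Pi.sub_apply, map_sub, h1, hW]
      by_cases hα : slice z α = 0
      · rw [if_pos hα]
        have : coeff α (z σ) = 0 := congrFun hα σ
        rw [this]
        simp [cechD]
      · rw [if_neg hα, ← hw' α σ hg]
        exact sub_self _

lemma slice_X_pow_smul (j : Fin n) (N : ℕ) (f : CechModule n k) (α : Fin n → ℤ) :
    slice ((X j ^ N : MvPolynomial (Fin n) k) • f) α = slice f (α - Pi.single j (N : ℤ)) :=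
  funext fun σ => coeff_X_pow_smul j N α (f σ)

lemma slice_X_smul (j : Fin n) (f : CechModule n k) (α : Fin n → ℤ) :
    slice ((X j : MvPolynomial (Fin n) k) • f) α = slice f (α - Pi.single j 1) :=
  funext fun σ => coeff_X_smul j α (f σ)

lemma exists_X_pow_smul_mem_cob {z : CechModule n k} (hz : z ∈ cochains n k i)
    (hz' : dL z ∈ bad k Δ) (j : Fin n) :
    ∃ N : ℕ, (X j ^ N : MvPolynomial (Fin n) k) • z ∈ cob k Δ i := by
  refine ⟨(finite_slice z).toFinset.sup fun α => (2 - α j).toNat, mem_cob_iff.2 fun γ => ?_⟩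
  have hle : ∀ α, slice z α ≠ 0 →
      2 - α j ≤ ((finite_slice z).toFinset.sup fun α => (2 - α j).toNat : ℕ) := by
    intro α hα
    refine (Int.self_le_toNat _).trans (Int.ofNat_le.2 ?_)
    exact Finset.le_sup (f := fun α : Fin n → ℤ => (2 - α j).toNat) (by simpa using hα)
  generalize (finite_slice z).toFinset.sup (fun α => (2 - α j).toNat) = N at hle ⊢
  rw [slice_X_pow_smul]
  by_cases h : slice z (γ - Pi.single j (N : ℤ)) = 0
  · rw [h]
    exact .zero
  · have h1 := hle _ h
    simp only [Pi.sub_apply, Pi.single_eq_same] at h1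
    refine ((isSliceCocycle_slice hz hz' _).le (sub_le_self _ ?_)).isSliceCoboundary_of_two_le
      (a := j) (by lia)
    exact Pi.single_nonneg.2 (by lia)

end CechModule
end

noncomputable section
variable {n : ℕ} {k : Type} [Field k]

namespace CechModule
open Laurent
variable {Δ : Set (Finset (Fin n))} {i : ℕ}

lemma exists_maxIdeal_pow_smul_mem_cob {z : CechModule n k} (hz : z ∈ cochains n k i)
    (hz' : dL z ∈ bad k Δ) : ∃ t, ∀ r ∈ maxIdeal k (Fin n) ^ t, r • z ∈ cob k Δ i := by
  let I : Ideal (MvPolynomial (Fin n) k) := (cob k Δ i).comap (LinearMap.toSpanSingleton _ _ z)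
  have h : maxIdeal k (Fin n) ≤ I.radical := by
    refine Ideal.span_le.2 ?_
    rintro _ ⟨j, rfl⟩
    obtain ⟨N, hN⟩ := exists_X_pow_smul_mem_cob hz hz' j
    exact ⟨N, hN⟩
  obtain ⟨t, ht⟩ := Ideal.exists_pow_le_of_le_radical_of_fg h
    ((isNoetherianRing_iff_ideal_fg _).1 inferInstance _)
  exact ⟨t, fun r hr => ht hr⟩

lemma Cech.exists_maxIdeal_pow_smul_mem_coboundaries (z : Cech k Δ i) (hz : Cech.d Δ i z = 0) :
    ∃ t, ∀ r ∈ maxIdeal k (Fin n) ^ t, r • z ∈ coboundaries (Cech.d Δ) i := by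
  obtain ⟨z, rfl⟩ := Cech.mk_surjective z
  rw [Cech.d_mk, Cech.mk_eq_zero] at hz
  obtain ⟨t, ht⟩ := exists_maxIdeal_pow_smul_mem_cob z.2 hz
  exact ⟨t, fun r hr => by rw [← map_smul, Cech.mk_mem_coboundaries]; exact ht r hr⟩

variable (k) in
/-- The ideal of polynomials annihilating the cohomology of the Čech complex in degree `i`. -/
def annCohomology (Δ : Set (Finset (Fin n))) (i : ℕ) : Ideal (MvPolynomial (Fin n) k) :=
  ⨅ z ∈ {z : CechModule n k | z ∈ cochains n k i ∧ dL z ∈ bad k Δ},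
    (cob k Δ i).comap (LinearMap.toSpanSingleton (MvPolynomial (Fin n) k) (CechModule n k) z)

lemma mem_annCohomology {x : MvPolynomial (Fin n) k} : x ∈ annCohomology k Δ i ↔
    ∀ z ∈ cochains n k i, dL z ∈ bad k Δ → x • z ∈ cob k Δ i := by
  simp [annCohomology]

lemma Cech.mem_annCohomology {x : MvPolynomial (Fin n) k} : x ∈ annCohomology k Δ i ↔
    ∀ z : Cech k Δ i, Cech.d Δ i z = 0 → x • z ∈ coboundaries (Cech.d Δ) i := by
  rw [CechModule.mem_annCohomology]
  constructor
  · intro h z hz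
    obtain ⟨z, rfl⟩ := Cech.mk_surjective z
    rw [Cech.d_mk, Cech.mk_eq_zero] at hz
    rw [← map_smul, Cech.mk_mem_coboundaries]
    exact h z z.2 hz
  · intro h z hz hz'
    have := h (Cech.mk Δ ⟨z, hz⟩) (by rwa [Cech.d_mk, Cech.mk_eq_zero])
    rwa [← map_smul, Cech.mk_mem_coboundaries] at this

lemma X_mul_X_mul_X_mem_annCohomology {G : SimpleGraph (Fin n)} {s : ℕ}
    (hs : maxIdeal k (Fin n) ^ s ≤ annCohomology k (indepComplex G) i) (a b c : Fin n) :
    (X a * X b * X c : MvPolynomial (Fin n) k) ∈ annCohomology k (indepComplex G) i := by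
  refine mem_annCohomology.2 fun z hz hz' => mem_cob_iff.2 fun γ => ?_
  rw [mul_smul, mul_smul, slice_X_smul, slice_X_smul, slice_X_smul]
  set α : Fin n → ℤ := γ - Pi.single a 1 - Pi.single b 1 - Pi.single c 1 with hα
  have hγ : γ = α + Pi.single c 1 + Pi.single b 1 + Pi.single a 1 := by rw [hα]; abel
  have hcoc := isSliceCocycle_slice hz hz' α
  by_cases h0 : 0 ≤ α
  · exact hcoc.isSliceCoboundary_of_three h0 hγ
  · obtain ⟨j, hj⟩ : ∃ j, α j < 0 := by simpa [Pi.le_def] using h0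
    obtain ⟨h1, h2⟩ := ofSlice_mem (hcoc.sub_single_of_neg hj s)
    have hX : (X j ^ s : MvPolynomial (Fin n) k) ∈ maxIdeal k (Fin n) ^ s :=
      Ideal.pow_mem_pow (Ideal.subset_span (Set.mem_range_self j)) s
    have h3 := mem_cob_iff.1 (mem_annCohomology.1 (hs hX) _ h1 h2) α
    rw [slice_X_pow_smul, slice_ofSlice_self] at h3
    refine h3.le ?_
    have hsingle (x : Fin n) : (0 : Fin n → ℤ) ≤ Pi.single x 1 := Pi.single_nonneg.2 zero_le_one
    rw [hγ, add_assoc, add_assoc]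
    exact le_add_of_nonneg_right (add_nonneg (hsingle _) (add_nonneg (hsingle _) (hsingle _)))

lemma maxIdeal_pow_three_le_annCohomology {G : SimpleGraph (Fin n)} {s : ℕ}
    (hs : maxIdeal k (Fin n) ^ s ≤ annCohomology k (indepComplex G) i) :
    maxIdeal k (Fin n) ^ 3 ≤ annCohomology k (indepComplex G) i := by
  rw [pow_three', maxIdeal, Ideal.span_mul_span', Ideal.span_mul_span', Ideal.span_le]
  rintro _ ⟨_, ⟨_, ⟨a, rfl⟩, _, ⟨b, rfl⟩, rfl⟩, _, ⟨c, rfl⟩, rfl⟩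
  exact X_mul_X_mul_X_mem_annCohomology hs a b c

lemma coeff_single_apply (σ τ : Finset (Fin n)) (f : Laurent n k) (α : Fin n → ℤ) :
    coeff α ((Pi.single σ f : CechModule n k) τ) = if τ = σ then coeff α f else 0 := by
  split_ifs with h
  · subst h
    rw [Pi.single_eq_same]
  · rw [Pi.single_eq_of_ne h, map_zero]

/-- The endomorphism of cochains given by an endomorphism of one component. -/
def component (σ : Finset (Fin n))
    (L : Laurent n k →ₗ[MvPolynomial (Fin n) k] Laurent n k) :
    CechModule n k →ₗ[MvPolynomial (Fin n) k] CechModule n k :=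
  LinearMap.single _ _ σ ∘ₗ L ∘ₗ LinearMap.proj σ

lemma component_apply (σ : Finset (Fin n))
    (L : Laurent n k →ₗ[MvPolynomial (Fin n) k] Laurent n k) (f : CechModule n k) :
    component σ L f = Pi.single σ (L (f σ)) := rfl

lemma restrictSupport_le_comap_component {P : Finset (Fin n) → (Fin n → ℤ) → Prop}
    {hP : ∀ σ α j, P σ α → P σ (α + Pi.single j 1)} {σ : Finset (Fin n)} {β : Fin n → ℤ}
    (h : ∀ α, P σ (α - β) → P σ α) :
    restrictSupport (k := k) P hP ≤ (restrictSupport P hP).comap (component σ (shift β)) := by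
  intro f hf τ α hα
  rw [component_apply, coeff_single_apply] at hα
  split_ifs at hα with hτ
  · subst hτ
    rw [coeff_shift] at hα
    exact h α (hf _ _ hα)
  · exact absurd rfl hα

lemma nonnegOff_congr {σ : Finset (Fin n)} {α β : Fin n → ℤ} (h : ∀ j ∉ σ, α j = β j)
    (hα : NonnegOff σ α) : NonnegOff σ β := fun j hj => h j hj ▸ hα j hj

lemma good_congr {σ : Finset (Fin n)} {α β : Fin n → ℤ} (h : ∀ j ∉ σ, α j = β j)
    (hα : Good Δ σ α) : Good Δ σ β := by
  obtain ⟨F, hF, hσ, hs⟩ := hα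
  refine ⟨F, hF, hσ, ?_⟩
  rwa [← Finset.sum_congr rfl fun j hj => h j fun hj' => Finset.mem_compl.1 hj (hσ hj')]

/-- Multiplication by a Laurent monomial supported on `σ` on the component at `σ` of the Čech
complex. -/
def Cech.componentShift (Δ : Set (Finset (Fin n))) (i : ℕ) (σ : Finset (Fin n)) (β : Fin n → ℤ)
    (hβ : ∀ j ∉ σ, β j = 0) : Cech k Δ i →ₗ[MvPolynomial (Fin n) k] Cech k Δ i :=
  Cech.map Δ (component σ (shift β))
    (restrictSupport_le_comap_component fun α h =>
      ⟨h.1, nonnegOff_congr (fun j hj => by simp [hβ j hj]) h.2⟩)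
    (restrictSupport_le_comap_component fun α h h' =>
      h (good_congr (fun j hj => by simp [hβ j hj]) h'))

lemma Cech.componentShift_mk (σ : Finset (Fin n)) (β : Fin n → ℤ) (hβ : ∀ j ∉ σ, β j = 0)
    (z : cochains n k i) : Cech.componentShift Δ i σ β hβ (Cech.mk Δ z) =
      Cech.mk Δ ⟨component σ (shift β) z, (restrictSupport_le_comap_component fun α h =>
      ⟨h.1, nonnegOff_congr (fun j hj => by simp [hβ j hj]) h.2⟩) z.2⟩ := rfl

lemma shift_zero (f : Laurent n k) : shift 0 f = f := by
  ext α
  rw [coeff_shift, sub_zero]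

lemma Cech.killsLoc_succ (i j : ℕ) : KillsLoc (maxIdeal k (Fin n)) j
    (ModuleCat.of (MvPolynomial (Fin n) k) (Cech k Δ (i + 1))) 1 := by
  refine killsLoc_one_of_locally_divisible
    (fun σ => Cech.componentShift Δ (i + 1) σ 0 fun _ _ => rfl) (fun z => ?_) (fun σ => ?_) j
  · obtain ⟨z, rfl⟩ := Cech.mk_surjective z
    simp only [Cech.componentShift_mk]
    rw [← map_sum]
    congr 1
    ext1
    rw [AddSubmonoidClass.coe_finsetSum]
    simp only [component_apply, shift_zero]
    exact Finset.univ_sum_single (z : CechModule n k)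
  · rcases σ.eq_empty_or_nonempty with rfl | ⟨l, hl⟩
    · refine ⟨0, zero_mem _, fun t => ⟨0, ?_⟩⟩
      rw [smul_zero]
      refine LinearMap.ext fun z => ?_
      obtain ⟨z, rfl⟩ := Cech.mk_surjective z
      rw [Cech.componentShift_mk, LinearMap.zero_apply, Cech.mk_eq_zero]
      have : (z : CechModule n k) ∅ = 0 := by
        ext α
        by_contra h
        exact absurd (z.2 ∅ α h).1 (by simp)
      simp [component_apply, this, zero_mem]
    · refine ⟨X l, Ideal.subset_span ⟨l, rfl⟩, fun t =>
        ⟨Cech.componentShift Δ (i + 1) σ (-Pi.single l (t : ℤ)) fun j hj => ?_, ?_⟩⟩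
      · have : j ≠ l := fun h => hj (h ▸ hl)
        simp [this]
      · refine LinearMap.ext fun z => ?_
        obtain ⟨z, rfl⟩ := Cech.mk_surjective z
        rw [LinearMap.smul_apply, Cech.componentShift_mk, Cech.componentShift_mk, ← map_smul]
        congr 1
        ext1
        simp only [Submodule.coe_smul, component_apply]
        rw [← Pi.single_smul, X_pow_smul_shift, shift_zero]

end CechModule
end

noncomputable section
variable {n : ℕ} {k : Type} [Field k]

lemma exists_single_add_single_le_iff {T : Finset (Fin n)} {β : Fin n →₀ ℕ} :
    (∃ i ∈ T, ∃ j ∈ T, Finsupp.single i 1 + Finsupp.single j 1 ≤ β) ↔ 2 ≤ ∑ l ∈ T, β l := by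
  constructor
  · rintro ⟨i, hi, j, hj, h⟩
    refine le_trans ?_ (Finset.sum_le_sum fun l _ => h l)
    simp [Finset.sum_add_distrib, Finsupp.single_apply, hi, hj]
  · intro h
    obtain ⟨i, hi, h1⟩ := Finset.exists_ne_zero_of_sum_ne_zero (by lia : ∑ l ∈ T, β l ≠ 0)
    have hle : Finsupp.single i 1 ≤ β := by
      rw [Finsupp.single_le_iff]
      lia
    obtain ⟨γ, rfl⟩ := exists_add_of_le hle
    have h2 : ∑ l ∈ T, (Finsupp.single i 1 + γ : Fin n →₀ ℕ) l = 1 + ∑ l ∈ T, γ l := by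
      simp [Finset.sum_add_distrib, Finsupp.single_apply, hi]
    obtain ⟨j, hj, h3⟩ := Finset.exists_ne_zero_of_sum_ne_zero (by lia : ∑ l ∈ T, γ l ≠ 0)
    refine ⟨i, hi, j, hj, add_le_add_right ?_ _⟩
    rw [Finsupp.single_le_iff]
    lia

lemma facePrime_sq (F : Finset (Fin n)) : facePrime k F ^ 2 =
    Ideal.span ((fun β : Fin n →₀ ℕ => monomial β (1 : k)) ''
      {β | ∃ i ∈ Fᶜ, ∃ j ∈ Fᶜ, Finsupp.single i 1 + Finsupp.single j 1 = β}) := by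
  rw [pow_two, facePrime, Ideal.span_mul_span']
  congr 1
  ext p
  constructor
  · rintro ⟨_, ⟨i, hi, rfl⟩, _, ⟨j, hj, rfl⟩, rfl⟩
    exact ⟨_, ⟨i, Finset.mem_compl.2 hi, j, Finset.mem_compl.2 hj, rfl⟩, by simp [X, monomial_mul]⟩
  · rintro ⟨_, ⟨i, hi, j, hj, rfl⟩, rfl⟩
    exact ⟨_, ⟨i, Finset.mem_compl.1 hi, rfl⟩, _, ⟨j, Finset.mem_compl.1 hj, rfl⟩, by
      simp [X, monomial_mul]⟩

lemma mem_facePrime_sq {F : Finset (Fin n)} {p : MvPolynomial (Fin n) k} :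
    p ∈ facePrime k F ^ 2 ↔ ∀ β ∈ p.support, 2 ≤ ∑ j ∈ Fᶜ, β j := by
  rw [facePrime_sq, mem_ideal_span_monomial_image]
  refine forall₂_congr fun β _ => ?_
  rw [← exists_single_add_single_le_iff]
  constructor
  · rintro ⟨_, ⟨i, hi, j, hj, rfl⟩, h⟩
    exact ⟨i, hi, j, hj, h⟩
  · rintro ⟨i, hi, j, hj, h⟩
    exact ⟨_, ⟨i, hi, j, hj, rfl⟩, h⟩

namespace CechModule
open Laurent
variable {Δ : Set (Finset (Fin n))}

lemma not_good_empty_iff {β : Fin n →₀ ℕ} :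
    ¬ Good Δ ∅ (expHom β) ↔ ∀ F ∈ facets Δ, 2 ≤ ∑ j ∈ Fᶜ, β j := by
  have h (F : Finset (Fin n)) : ∑ j ∈ Fᶜ, expHom β j = (∑ j ∈ Fᶜ, β j : ℕ) := by
    simp [expHom]
  constructor
  · intro hg F hF
    by_contra hlt
    exact hg ⟨F, hF, Finset.empty_subset F, by rw [h]; lia⟩
  · rintro hg ⟨F, hF, -, hs⟩
    have := hg F hF
    rw [h] at hs
    lia

lemma mem_symbolicPower_two {p : MvPolynomial (Fin n) k} :
    p ∈ symbolicPower k Δ 2 ↔ ∀ β ∈ p.support, ¬ Good Δ ∅ (expHom β) := by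
  simp only [symbolicPower, Ideal.mem_iInf, mem_facePrime_sq, not_good_empty_iff]
  exact ⟨fun h β hβ F hF => h F hF β hβ, fun h F hF β hβ => h β hβ F hF⟩

lemma single_ofPolynomial_mem (p : MvPolynomial (Fin n) k) :
    (Pi.single ∅ (ofPolynomial p) : CechModule n k) ∈ cochains n k 0 := by
  intro σ α h
  rw [coeff_single_apply] at h
  split_ifs at h with hσ
  · obtain ⟨β, -, rfl⟩ := exists_of_coeff_ofPolynomial_ne_zero h
    exact ⟨by simp [hσ], fun j _ => Int.natCast_nonneg _⟩
  · exact absurd rfl h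

/-- Polynomials as Čech cochains of degree zero. -/
def ofPolynomial₀ : MvPolynomial (Fin n) k →ₗ[MvPolynomial (Fin n) k] cochains n k 0 where
  toFun p := ⟨Pi.single ∅ (ofPolynomial p), single_ofPolynomial_mem p⟩
  map_add' p q := by
    ext1
    simp [Pi.single_add]
  map_smul' p q := by
    ext1
    simp only [smul_eq_mul, map_mul, Submodule.coe_smul, RingHom.id_apply]
    rw [← Pi.single_smul, smul_def]

lemma coe_ofPolynomial₀ (p : MvPolynomial (Fin n) k) :
    (ofPolynomial₀ p : CechModule n k) = (Pi.single ∅ (ofPolynomial p) : CechModule n k) := rfl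

lemma exists_ofPolynomial_eq {f : Laurent n k} (hf : ∀ α, coeff α f ≠ 0 → 0 ≤ α) :
    ∃ p : MvPolynomial (Fin n) k, ofPolynomial p = f := by
  let p : MvPolynomial (Fin n) k := AddMonoidAlgebra.ofCoeff
    (Finsupp.comapDomain expHom (AddMonoidAlgebra.coeff f) expHom_injective.injOn)
  have hp (β) : p.coeff β = coeff (expHom β) f := rfl
  refine ⟨p, Laurent.ext fun α => ?_⟩
  by_cases hα : 0 ≤ α
  · obtain ⟨β, rfl⟩ : ∃ β, expHom β = α :=
      ⟨Finsupp.equivFunOnFinite.symm fun j => (α j).toNat, funext fun j =>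
        Int.toNat_of_nonneg (hα j)⟩
    rw [coeff_ofPolynomial, hp]
  · rw [of_not_not fun h => hα (hf α h)]
    by_contra h
    obtain ⟨β, -, rfl⟩ := exists_of_coeff_ofPolynomial_ne_zero h
    exact hα fun j => Int.natCast_nonneg _

lemma ofPolynomial₀_surjective : Function.Surjective (ofPolynomial₀ (n := n) (k := k)) := by
  intro z
  obtain ⟨p, hp⟩ := exists_ofPolynomial_eq (f := (z : CechModule n k) ∅) fun α h j =>
    (z.2 ∅ α h).2 j (Finset.notMem_empty j)
  refine ⟨p, Subtype.ext <| funext fun σ => Laurent.ext fun α => ?_⟩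
  rw [coe_ofPolynomial₀, coeff_single_apply, hp]
  split_ifs with hσ
  · rw [hσ]
  · by_contra h
    exact hσ (Finset.card_eq_zero.1 (z.2 σ α (Ne.symm h)).1)

lemma mk_ofPolynomial₀_eq_zero {p : MvPolynomial (Fin n) k} :
    Cech.mk Δ (ofPolynomial₀ p) = 0 ↔ p ∈ symbolicPower k Δ 2 := by
  rw [Cech.mk_eq_zero, mem_symbolicPower_two]
  constructor
  · intro h β hβ
    refine h ∅ (expHom β) ?_
    rw [coe_ofPolynomial₀, Pi.single_eq_same, coeff_ofPolynomial]
    exact mem_support_iff.1 hβ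
  · intro h σ α hα
    rw [coe_ofPolynomial₀, coeff_single_apply] at hα
    split_ifs at hα with hσ
    · obtain ⟨β, hβ, rfl⟩ := exists_of_coeff_ofPolynomial_ne_zero hα
      exact hσ ▸ h β hβ
    · exact absurd rfl hα

variable (k Δ) in
/-- The quotient by the second symbolic power as the first term of its Čech complex. -/
def quotientEquivCech : (MvPolynomial (Fin n) k ⧸ symbolicPower k Δ 2) ≃ₗ[MvPolynomial (Fin n) k]
    Cech k Δ 0 :=
  (Submodule.quotEquivOfEq _ _ (by
    ext p
    exact mk_ofPolynomial₀_eq_zero.symm)).trans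
  (LinearMap.quotKerEquivOfSurjective (Cech.mk Δ ∘ₗ ofPolynomial₀)
    (Cech.mk_surjective.comp ofPolynomial₀_surjective))

lemma smul_localCohomology_eq_zero_iff {i : ℕ} {x : MvPolynomial (Fin n) k} :
    (∀ y : locCoh k (Fin n) (symbolicPower k Δ 2) i, x • y = 0) ↔ x ∈ annCohomology k Δ i := by
  rw [Cech.mem_annCohomology]
  refine (killsLoc_iff _ i _ x).symm.trans (Iff.trans ?_ (killsLoc_iff_of_complex (C := Cech k Δ)
    (Cech.d Δ) Cech.d_d Cech.killsLoc_succ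
    (fun _ => Cech.exists_maxIdeal_pow_smul_mem_coboundaries) i x))
  have e := (quotientEquivCech k Δ).toModuleIso
  exact ⟨KillsLoc.of_iso e, KillsLoc.of_iso e.symm⟩

end CechModule

end

/-- **Corollary 3.9.** If `S/I(G)^{(2)}` is generalized Cohen–Macaulay, then it is
3-Buchsbaum. -/
theorem three_buchsbaum_of_gCM {n : ℕ} (k : Type) [Field k]
    (G : SimpleGraph (Fin n)) (hiso : noIsolated G)
    (hgcm : quotGCM k (Fin n) (symbolicPower k (indepComplex G) 2)) :
    quotKBuchsbaum k (Fin n) (symbolicPower k (indepComplex G) 2) 3 := by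
  intro i hi x hx
  obtain ⟨s, hs⟩ := exists_pow_smul_eq_zero_of_isFiniteLength (hgcm i hi)
  rw [CechModule.smul_localCohomology_eq_zero_iff]
  exact CechModule.maxIdeal_pow_three_le_annCohomology
    (fun y hy => CechModule.smul_localCohomology_eq_zero_iff.1 (hs y hy)) hx
end

section
/- Let G be the 4-cycle with edges {12, 23, 34, 14} and I = I(G) ⊆ S = k[x_1,x_2,x_3,x_4]. Then S/I^{(2)} is generalized Cohen-Macaulay of dimension 2, and x_1 x_2 · H^1_m(S/I^{(2)})_0 ≠ 0; in particular m^2 · H^1_m(S/I^{(2)}) ≠ 0, so S/I^{(2)} is not 2-Buchsbaum. -/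
open MvPolynomial CategoryTheory CategoryTheory.Limits

/-- The 4-cycle (square) with edges `{12, 23, 34, 14}`, on vertices `0,1,2,3`. -/
def squareGraph : SimpleGraph (Fin 4) :=
  SimpleGraph.fromRel fun u v =>
    (u = 0 ∧ v = 1) ∨ (u = 1 ∧ v = 2) ∨ (u = 2 ∧ v = 3) ∨ (u = 0 ∧ v = 3)

section LeftDerived

variable {C D : Type*} [Category* C] [Category* D] [Abelian C]
  [Abelian D] (S : ShortComplex (C ⥤ D)) [S.X₁.Additive] [S.X₂.Additive] [S.X₃.Additive]

/-- The short complex of chain complexes obtained by applying a short complex of additive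
functors to a chain complex. -/
noncomputable def mapChainShortComplex (K : ChainComplex C ℕ) : ShortComplex (ChainComplex D ℕ) :=
  ShortComplex.mk ((NatTrans.mapHomologicalComplex S.f _).app K)
    ((NatTrans.mapHomologicalComplex S.g _).app K) (by
      ext i
      exact congr_app S.zero (K.X i))

/-- A morphism of chain complexes induces a morphism of the associated short complexes. -/
noncomputable def mapChainShortComplexHom {K L : ChainComplex C ℕ} (φ : K ⟶ L) :
    mapChainShortComplex S K ⟶ mapChainShortComplex S L where
  τ₁ := (S.X₁.mapHomologicalComplex _).map φ
  τ₂ := (S.X₂.mapHomologicalComplex _).map φ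
  τ₃ := (S.X₃.mapHomologicalComplex _).map φ
  comm₁₂ := ((NatTrans.mapHomologicalComplex S.f _).naturality φ)
  comm₂₃ := ((NatTrans.mapHomologicalComplex S.g _).naturality φ)

variable {S}

theorem mapChainShortComplex_shortExact
    (hS : ∀ (P : C) [Projective P], (S.map ((evaluation C D).obj P)).ShortExact)
    {X : C} (P : ProjectiveResolution X) :
    (mapChainShortComplex S P.complex).ShortExact :=
  HomologicalComplex.shortExact_of_degreewise_shortExact _ fun i => hS (P.complex.X i)

theorem down_rel_succ (n : ℕ) : (ComplexShape.down ℕ).Rel (n + 1) n := rfl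

variable (hS : ∀ (P : C) [Projective P], (S.map ((evaluation C D).obj P)).ShortExact)

/-- The connecting morphism in homology computed with a projective resolution. -/
noncomputable def resolutionδ {X : C} (P : ProjectiveResolution X) (n : ℕ) :
    (HomologicalComplex.homologyFunctor D _ (n + 1)).obj
      ((S.X₃.mapHomologicalComplex _).obj P.complex) ⟶
    (HomologicalComplex.homologyFunctor D _ n).obj ((S.X₁.mapHomologicalComplex _).obj P.complex) :=
  (mapChainShortComplex_shortExact hS P).δ (n + 1) n (down_rel_succ n)

theorem resolutionδ_naturality {X Y : C} (P : ProjectiveResolution X) (Q : ProjectiveResolution Y)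
    (φ : P.complex ⟶ Q.complex) (n : ℕ) :
    resolutionδ hS P n ≫
      (S.X₁.mapHomologicalComplex _ ⋙ HomologicalComplex.homologyFunctor _ _ n).map φ =
    (S.X₃.mapHomologicalComplex _ ⋙ HomologicalComplex.homologyFunctor _ _ (n + 1)).map φ ≫
      resolutionδ hS Q n :=
  HomologicalComplex.HomologySequence.δ_naturality (mapChainShortComplexHom S φ)
    (mapChainShortComplex_shortExact hS P) (mapChainShortComplex_shortExact hS Q) (n + 1) n
    (down_rel_succ n)

variable [HasProjectiveResolutions C]

/-- The connecting morphism of left derived functors attached to a short complex of functors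
which is short exact on projective objects. -/
noncomputable def leftDerivedδ (n : ℕ) : S.X₃.leftDerived (n + 1) ⟶ S.X₁.leftDerived n where
  app X := ((projectiveResolution X).isoLeftDerivedObj S.X₃ (n + 1)).hom ≫
    resolutionδ hS (projectiveResolution X) n ≫
    ((projectiveResolution X).isoLeftDerivedObj S.X₁ n).inv
  naturality {X Y} f := by
    have comm : (ProjectiveResolution.lift f (projectiveResolution X) (projectiveResolution Y)).f 0
        ≫ (projectiveResolution Y).π.f 0 = (projectiveResolution X).π.f 0 ≫ f :=
      ProjectiveResolution.lift_commutes_zero _ _ _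
    rw [ProjectiveResolution.isoLeftDerivedObj_hom_naturality_assoc f _ _ _ comm,
      Category.assoc, Category.assoc,
      ProjectiveResolution.isoLeftDerivedObj_inv_naturality f _ _ _ comm]
    exact congrArg (_ ≫ ·) ((reassoc_of% (resolutionδ_naturality hS (projectiveResolution X)
      (projectiveResolution Y) (ProjectiveResolution.lift f _ _) n)) _).symm

theorem isIso_leftDerivedδ_app (n : ℕ) (X : C) (h₁ : IsZero ((S.X₂.leftDerived (n + 1)).obj X))
    (h₂ : IsZero ((S.X₂.leftDerived n).obj X)) : IsIso ((leftDerivedδ hS n).app X) := by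
  have hP := mapChainShortComplex_shortExact hS (projectiveResolution X)
  have e₁ := h₁.of_iso ((projectiveResolution X).isoLeftDerivedObj S.X₂ (n + 1)).symm
  have e₂ := h₂.of_iso ((projectiveResolution X).isoLeftDerivedObj S.X₂ n).symm
  have : IsIso (resolutionδ hS (projectiveResolution X) n) :=
    have : Mono (resolutionδ hS (projectiveResolution X) n) :=
      (hP.homology_exact₃ (n + 1) n (down_rel_succ n)).mono_g (e₁.eq_of_src _ _)
    have : Epi (resolutionδ hS (projectiveResolution X) n) :=
      (hP.homology_exact₁ (n + 1) n (down_rel_succ n)).epi_f (e₂.eq_of_tgt _ _)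
    isIso_of_mono_of_epi _
  dsimp only [leftDerivedδ]
  infer_instance

theorem isZero_leftDerived_X₂
    (hS : ∀ (P : C) [Projective P], (S.map ((evaluation C D).obj P)).ShortExact)
    (n : ℕ) (X : C) (h₁ : IsZero ((S.X₁.leftDerived n).obj X))
    (h₃ : IsZero ((S.X₃.leftDerived n).obj X)) : IsZero ((S.X₂.leftDerived n).obj X) := by
  have hP := mapChainShortComplex_shortExact hS (projectiveResolution X)
  have e₁ := h₁.of_iso ((projectiveResolution X).isoLeftDerivedObj S.X₁ n).symm
  have e₃ := h₃.of_iso ((projectiveResolution X).isoLeftDerivedObj S.X₃ n).symm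
  refine IsZero.of_iso ?_ ((projectiveResolution X).isoLeftDerivedObj S.X₂ n)
  exact (hP.homology_exact₂ n).isZero_X₂ (e₁.eq_of_src _ _) (e₃.eq_of_tgt _ _)

theorem epi_leftDerived_g
    (hS : ∀ (P : C) [Projective P], (S.map ((evaluation C D).obj P)).ShortExact)
    (n : ℕ) (X : C) (h₁ : IsZero ((S.X₁.leftDerived n).obj X)) :
    Epi ((NatTrans.leftDerived S.g (n + 1)).app X) := by
  have hP := mapChainShortComplex_shortExact hS (projectiveResolution X)
  have e₁ := h₁.of_iso ((projectiveResolution X).isoLeftDerivedObj S.X₁ n).symm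
  have : Epi (HomologicalComplex.homologyMap (mapChainShortComplex S
    (projectiveResolution X).complex).g (n + 1)) :=
      (hP.homology_exact₃ (n + 1) n (down_rel_succ n)).epi_f (e₁.eq_of_tgt _ _)
  rw [ProjectiveResolution.leftDerived_app_eq S.g (projectiveResolution X)]
  exact epi_comp' inferInstance (epi_comp' this inferInstance)

/-- A natural endomorphism of the identity functor acts on a left derived functor through the
functor itself. -/
theorem leftDerived_app_eq_map (F : C ⥤ D) [F.Additive] (γ : 𝟭 C ⟶ 𝟭 C) (α : F ⟶ F)
    (h : ∀ X, α.app X = F.map (γ.app X)) (n : ℕ) (X : C) :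
    (NatTrans.leftDerived α n).app X = (F.leftDerived n).map (γ.app X) := by
  let φ : (projectiveResolution X).complex ⟶ (projectiveResolution X).complex :=
    { f := fun i => γ.app ((projectiveResolution X).complex.X i)
      comm' := fun i j _ => (γ.naturality _).symm }
  rw [ProjectiveResolution.leftDerived_app_eq α (projectiveResolution X),
    Functor.leftDerived_map_eq F n (γ.app X) φ (by
      ext
      have := (γ.naturality ((projectiveResolution X).π.f 0)).symm
      simp only [Functor.id_obj, Functor.id_map, φ] at this ⊢
      simpa using this)]
  congr 3
  ext i
  exact h _

end LeftDerived

section ExtModule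

variable {R : Type} [CommRing R]

/-- The contravariant functor `Hom(-, Y)`, with values in the opposite category. -/
noncomputable abbrev homOp (Y : ModuleCat.{0} R) : ModuleCat.{0} R ⥤ (ModuleCat.{0} R)ᵒᵖ :=
  ((linearYoneda R (ModuleCat.{0} R)).obj Y).rightOp

/-- The transformation `Hom(-, Z) ⟶ Hom(-, Y)` in the opposite category induced by `Y ⟶ Z`. -/
noncomputable abbrev homOpMap {Y Z : ModuleCat.{0} R} (f : Y ⟶ Z) : homOp Z ⟶ homOp Y :=
  NatTrans.rightOp ((linearYoneda R (ModuleCat.{0} R)).map f)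

/-- The short complex of functors `Hom(-, T)` attached to a short complex of modules `T`. -/
noncomputable def homOpShortComplex (T : ShortComplex (ModuleCat.{0} R)) :
    ShortComplex (ModuleCat.{0} R ⥤ (ModuleCat.{0} R)ᵒᵖ) :=
  ShortComplex.mk (X₁ := homOp T.X₃) (X₂ := homOp T.X₂) (X₃ := homOp T.X₁)
    (homOpMap T.g) (homOpMap T.f) (by
      ext X
      refine Quiver.Hom.unop_inj ?_
      ext (f : X ⟶ T.X₁)
      change (f ≫ T.f) ≫ T.g = 0
      simp)

instance (T : ShortComplex (ModuleCat.{0} R)) : (homOpShortComplex T).X₁.Additive :=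
  inferInstanceAs (homOp T.X₃).Additive
instance (T : ShortComplex (ModuleCat.{0} R)) : (homOpShortComplex T).X₂.Additive :=
  inferInstanceAs (homOp T.X₂).Additive
instance (T : ShortComplex (ModuleCat.{0} R)) : (homOpShortComplex T).X₃.Additive :=
  inferInstanceAs (homOp T.X₁).Additive

theorem homOpShortComplex_shortExact {T : ShortComplex (ModuleCat.{0} R)} (hT : T.ShortExact)
    (P : ModuleCat.{0} R) [Projective P] :
    ((homOpShortComplex T).map ((evaluation _ _).obj P)).ShortExact := by
  have := hT.mono_f
  have := hT.epi_g
  let U : ShortComplex (ModuleCat.{0} R) := ShortComplex.mk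
    (((linearYoneda R (ModuleCat.{0} R)).map T.f).app (Opposite.op P))
    (((linearYoneda R (ModuleCat.{0} R)).map T.g).app (Opposite.op P)) (by
      ext (f : P ⟶ T.X₁)
      change (f ≫ T.f) ≫ T.g = 0
      simp)
  have hU : U.ShortExact := by
    refine { exact := ?_, mono_f := ?_, epi_g := ?_ }
    · rw [ShortComplex.moduleCat_exact_iff]
      intro (f : P ⟶ T.X₂) (hf : f ≫ T.g = 0)
      exact ⟨hT.exact.lift f hf, hT.exact.lift_f f hf⟩
    · rw [ModuleCat.mono_iff_injective]
      intro (f : P ⟶ T.X₁) (g : P ⟶ T.X₁) (h : f ≫ T.f = g ≫ T.f)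
      exact (cancel_mono T.f).mp h
    · rw [ModuleCat.epi_iff_surjective]
      intro (f : P ⟶ T.X₃)
      exact ⟨Projective.factorThru f T.g, Projective.factorThru_comp f T.g⟩
  exact hU.op

instance (Y : ModuleCat.{0} R) : PreservesFiniteColimits (homOp Y) := by
  have : PreservesLimitsOfSize.{0,0} ((linearYoneda R (ModuleCat.{0} R)).obj Y) := by
    have : PreservesLimitsOfSize.{0,0} (((linearYoneda R (ModuleCat.{0} R)).obj Y) ⋙ forget _) :=
      inferInstanceAs (PreservesLimitsOfSize.{0,0} (yoneda.obj Y))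
    exact preservesLimits_of_reflects_of_preserves _ (forget (ModuleCat.{0} R))
  have : PreservesFiniteLimits ((linearYoneda R (ModuleCat.{0} R)).obj Y) := inferInstance
  exact preservesFiniteColimits_rightOp _

theorem isZero_leftDerived_zero_homOp {X Y : ModuleCat.{0} R} (h : Subsingleton (X ⟶ Y)) :
    IsZero (((homOp Y).leftDerived 0).obj X) := by
  refine IsZero.of_iso ?_ ((homOp Y).leftDerivedZeroIsoSelf.app X)
  refine IsZero.op (ModuleCat.isZero_of_iff_subsingleton.mpr h)

/-- Multiplication by `r` as a natural endomorphism of the identity functor. -/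
noncomputable def smulIdNat (r : R) : 𝟭 (ModuleCat.{0} R) ⟶ 𝟭 (ModuleCat.{0} R) where
  app X := r • 𝟙 X
  naturality X Y f := by simp

theorem leftDerived_map_zero {C D : Type*} [Category* C] [Category* D] [Abelian C]
    [HasProjectiveResolutions C] [Abelian D] (F : C ⥤ D) [F.Additive] (n : ℕ) (X Y : C) :
    (F.leftDerived n).map (0 : X ⟶ Y) = 0 := by
  rw [Functor.leftDerived_map_eq F n (P := projectiveResolution X) (Q := projectiveResolution Y)
    0 0 (by simp), Functor.map_zero]
  simp

theorem isZero_leftDerived_succ_of_smul {N N' X : ModuleCat.{0} R} {r : R} {g : N ⟶ N'}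
    {w : (r • 𝟙 N) ≫ g = 0} (hT : (ShortComplex.mk (r • 𝟙 N) g w).ShortExact) (n t : ℕ)
    (hX : r ^ t • 𝟙 X = 0) (h : IsZero (((homOp N').leftDerived n).obj X)) :
    IsZero (((homOp N).leftDerived (n + 1)).obj X) := by
  have key : Epi (((homOp N).leftDerived (n + 1)).map (r • 𝟙 X)) := by
    have := epi_leftDerived_g (homOpShortComplex_shortExact hT) n X h
    have h' := leftDerived_app_eq_map (homOp N) (smulIdNat r) (homOpMap (r • 𝟙 N)) (fun Y => by
      refine Quiver.Hom.unop_inj ?_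
      ext (f : Y ⟶ N)
      change f ≫ (r • 𝟙 N) = (r • 𝟙 Y) ≫ f
      simp) (n + 1) X
    exact h' ▸ this
  have epi_pow : ∀ s : ℕ, Epi (((homOp N).leftDerived (n + 1)).map (r ^ s • 𝟙 X)) := by
    intro s
    induction s with
    | zero => simp only [pow_zero, one_smul, CategoryTheory.Functor.map_id]; infer_instance
    | succ s ih =>
      have : r ^ (s + 1) • 𝟙 X = (r ^ s • 𝟙 X) ≫ (r • 𝟙 X) := by
        simp [smul_smul, pow_succ, mul_comm]
      rw [this, Functor.map_comp]
      exact epi_comp _ _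
  have h0 := epi_pow t
  rw [hX] at h0
  exact @IsZero.of_epi_eq_zero _ _ _ _ _ _ h0 (leftDerived_map_zero _ _ _ _)

/-- If `α : Lᵢ Hom(-, A) ⟶ Hom(-, B)` is invertible on a diagram of quotients `R ⧸ I d`, then
`Extⁱ(R ⧸ I d, A)` is `Hom(R ⧸ I d, B)` naturally in `d`. -/
noncomputable def diagramIso {D : Type} [SmallCategory D] (I : D ⥤ Ideal R)
    {A B : ModuleCat.{0} R} {i : ℕ} (α : (homOp A).leftDerived i ⟶ homOp B)
    (h : ∀ d, IsIso (α.app ((localCohomology.ringModIdeals I).obj d))) :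
    (localCohomology.ringModIdeals I).op ⋙ (linearYoneda R (ModuleCat.{0} R)).obj B ≅
      localCohomology.diagram I i ⋙ (evaluation _ _).obj A :=
  let β : (localCohomology.ringModIdeals I).op ⋙ (linearYoneda R (ModuleCat.{0} R)).obj B ⟶
      localCohomology.diagram I i ⋙ (evaluation _ _).obj A :=
    Functor.whiskerLeft (localCohomology.ringModIdeals I).op (NatTrans.leftOp α)
  have : ∀ d, IsIso (β.app d) := fun d =>
    have := h d.unop
    inferInstanceAs (IsIso (α.app ((localCohomology.ringModIdeals I).obj d.unop)).unop)
  have := NatIso.isIso_of_isIso_app β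
  asIso β

/-- Evaluation at `1` of morphisms out of the quotients `R ⧸ I d`. -/
noncomputable def evalOneCocone {D : Type} [SmallCategory D] (I : D ⥤ Ideal R)
    (B : ModuleCat.{0} R) :
    Cocone ((localCohomology.ringModIdeals I).op ⋙ (linearYoneda R (ModuleCat.{0} R)).obj B) where
  pt := B
  ι :=
    { app := fun d => ModuleCat.ofHom
        { toFun := fun f : (localCohomology.ringModIdeals I).obj d.unop ⟶ B =>
            f.hom (Submodule.Quotient.mk 1)
          map_add' := fun _ _ => rfl
          map_smul' := fun _ _ => rfl }
      naturality := fun _ _ _ => rfl }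

theorem isColimit_exists_injective (J : Ideal R) {B : ModuleCat.{0} R}
    {c : Cocone ((localCohomology.ringModIdeals (localCohomology.idealPowersDiagram J)).op ⋙
      (linearYoneda R (ModuleCat.{0} R)).obj B)} (hc : IsColimit c) :
    ∃ f : c.pt →ₗ[R] B, Function.Injective f ∧
      ∀ b, b ∈ LinearMap.range f ↔ ∃ t : ℕ, ∀ r ∈ J ^ t, r • b = 0 := by
  let f : c.pt ⟶ B := hc.desc (evalOneCocone _ B)
  have hf : ∀ (t : ℕᵒᵖᵒᵖ) (x : ModuleCat.of R (R ⧸ J ^ t.unop.unop) ⟶ B),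
      f.hom ((c.ι.app t).hom x) = x.hom (Submodule.Quotient.mk 1) := fun t x =>
    ConcreteCategory.congr_hom (hc.fac (evalOneCocone _ B) t) x
  have hrep : ∀ y : c.pt, ∃ (t : ℕᵒᵖᵒᵖ) (x : ModuleCat.of R (R ⧸ J ^ t.unop.unop) ⟶ B),
      (c.ι.app t).hom x = y := fun y => Concrete.isColimit_exists_rep _ hc y
  refine ⟨f.hom, ?_, fun b => ⟨?_, ?_⟩⟩
  · rw [injective_iff_map_eq_zero]
    intro y hy
    obtain ⟨t, x, rfl⟩ := hrep y
    rw [hf] at hy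
    have : x = 0 := by
      ext
      exact hy
    rw [this]
    exact map_zero (c.ι.app t).hom
  · rintro ⟨y, rfl⟩
    obtain ⟨t, x, rfl⟩ := hrep y
    refine ⟨t.unop.unop, fun r hr => ?_⟩
    rw [hf, ← map_smul, ← Submodule.Quotient.mk_smul, smul_eq_mul, mul_one,
      (Submodule.Quotient.mk_eq_zero _).mpr hr, map_zero]
  · rintro ⟨t, ht⟩
    obtain ⟨s, rfl⟩ : ∃ s : ℕᵒᵖᵒᵖ, s.unop.unop = t := ⟨Opposite.op (Opposite.op t), rfl⟩
    let x : ModuleCat.of R (R ⧸ J ^ s.unop.unop) ⟶ B :=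
      ModuleCat.ofHom (Submodule.liftQ (J ^ s.unop.unop) (LinearMap.toSpanSingleton R B b) ht)
    exact ⟨(c.ι.app s).hom x, (hf s x).trans (one_smul R b)⟩

/-- If `Extⁱ(R ⧸ Jᵗ, A)` is `Hom(R ⧸ Jᵗ, B)` naturally in `t`, then `Hⁱ_J(A)` is the `J`-power
torsion submodule of `B`. -/
theorem localCohomology_exists_injective (J : Ideal R) {A B : ModuleCat.{0} R} {i : ℕ}
    (α : (homOp A).leftDerived i ⟶ homOp B)
    (h : ∀ t : ℕ, IsIso (α.app (ModuleCat.of R (R ⧸ J ^ t)))) :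
    ∃ f : (localCohomology J i).obj A →ₗ[R] B, Function.Injective f ∧
      ∀ b, b ∈ LinearMap.range f ↔ ∃ t : ℕ, ∀ r ∈ J ^ t, r • b = 0 := by
  have : HasColimit (localCohomology.diagram (localCohomology.idealPowersDiagram J) i) :=
    localCohomology.hasColimitDiagram.{0, 0} _ i
  have hc := isColimitOfPreserves ((evaluation (ModuleCat.{0} R) (ModuleCat.{0} R)).obj A)
    (colimit.isColimit (localCohomology.diagram (localCohomology.idealPowersDiagram J) i))
  have h' : ∀ d : ℕᵒᵖ, IsIso (α.app ((localCohomology.ringModIdeals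
    (localCohomology.idealPowersDiagram J)).obj d)) := fun d => h d.unop
  have e := diagramIso (localCohomology.idealPowersDiagram J) α h'
  have hc' := (IsColimit.precomposeHomEquiv e _).symm hc
  exact isColimit_exists_injective J hc'

end ExtModule

section TwoIdeals

variable {R : Type} [CommRing R]

theorem localCohomology_zero_exists_injective (J : Ideal R) (A : ModuleCat.{0} R) :
    ∃ f : (localCohomology J 0).obj A →ₗ[R] A, Function.Injective f ∧
      ∀ b, b ∈ LinearMap.range f ↔ ∃ t : ℕ, ∀ r ∈ J ^ t, r • b = 0 :=
  localCohomology_exists_injective J (homOp A).leftDerivedZeroIsoSelf.hom fun _ => inferInstance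

theorem localCohomology_one_exists_injective (J : Ideal R) {T : ShortComplex (ModuleCat.{0} R)}
    (hT : T.ShortExact)
    (h₀ : ∀ t : ℕ, IsZero (((homOp T.X₂).leftDerived 0).obj (ModuleCat.of R (R ⧸ J ^ t))))
    (h₁ : ∀ t : ℕ, IsZero (((homOp T.X₂).leftDerived 1).obj (ModuleCat.of R (R ⧸ J ^ t)))) :
    ∃ f : (localCohomology J 1).obj T.X₁ →ₗ[R] T.X₃, Function.Injective f ∧
      ∀ b, b ∈ LinearMap.range f ↔ ∃ t : ℕ, ∀ r ∈ J ^ t, r • b = 0 :=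
  localCohomology_exists_injective J
    (leftDerivedδ (homOpShortComplex_shortExact hT) 0 ≫ (homOp T.X₃).leftDerivedZeroIsoSelf.hom)
    fun t => by
      have := isIso_leftDerivedδ_app (homOpShortComplex_shortExact hT) 0 _ (h₁ t) (h₀ t)
      exact IsIso.comp_isIso' this (NatIso.hom_app_isIso (homOp T.X₃).leftDerivedZeroIsoSelf _)

theorem mem_of_pow_mul_mem {I : Ideal R} {a : R} (hreg : ∀ r, a * r ∈ I → r ∈ I) (t : ℕ) {r : R}
    (h : a ^ t * r ∈ I) : r ∈ I := by
  induction t with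
  | zero => simpa using h
  | succ t ih => exact ih (hreg _ (by rwa [pow_succ', mul_assoc] at h))

theorem isZero_leftDerived_zero_quotient {I J : Ideal R} {a : R} (ha : a ∈ J)
    (hreg : ∀ r, a * r ∈ I → r ∈ I) (t : ℕ) :
    IsZero (((homOp (ModuleCat.of R (R ⧸ I))).leftDerived 0).obj (ModuleCat.of R (R ⧸ J ^ t))) := by
  refine isZero_leftDerived_zero_homOp (subsingleton_of_forall_eq 0 fun f => ?_)
  ext
  obtain ⟨r, hr⟩ := Ideal.Quotient.mk_surjective (f.hom (Submodule.Quotient.mk 1))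
  have h : a ^ t • f.hom (Submodule.Quotient.mk 1) = 0 := by
    rw [← map_smul, ← Submodule.Quotient.mk_smul, smul_eq_mul, mul_one,
      (Submodule.Quotient.mk_eq_zero _).mpr (Ideal.pow_mem_pow ha t), map_zero]
  have hr0 : f.hom (Submodule.Quotient.mk 1) = 0 := by
    rw [← hr]
    refine Ideal.Quotient.eq_zero_iff_mem.mpr (mem_of_pow_mul_mem hreg t
      (Ideal.Quotient.eq_zero_iff_mem.mp ?_))
    rw [map_mul, hr]
    exact h
  exact hr0

theorem isZero_leftDerived_one_quotient {I J : Ideal R} {a b : R} (ha : a ∈ J) (hb : b ∈ J)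
    (hreg : ∀ r, a * r ∈ I → r ∈ I)
    (hreg' : ∀ r, b * r ∈ I ⊔ Ideal.span {a} → r ∈ I ⊔ Ideal.span {a}) (t : ℕ) :
    IsZero (((homOp (ModuleCat.of R (R ⧸ I))).leftDerived 1).obj (ModuleCat.of R (R ⧸ J ^ t))) := by
  let g : R ⧸ I →ₗ[R] R ⧸ (I ⊔ Ideal.span {a}) := Submodule.factor le_sup_left
  refine isZero_leftDerived_succ_of_smul (r := a) (g := ModuleCat.ofHom g) (w := ?_)
    { exact := ?_, mono_f := ?_, epi_g := ?_ } 0 t ?_ (isZero_leftDerived_zero_quotient hb hreg' t)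
  · ext
    change Submodule.Quotient.mk (a • (1 : R)) = 0
    exact (Submodule.Quotient.mk_eq_zero _).mpr (Ideal.mem_sup_right (by simp))
  · rw [ShortComplex.moduleCat_exact_iff]
    intro (x : R ⧸ I) (hx : g x = 0)
    obtain ⟨x, rfl⟩ := Submodule.Quotient.mk_surjective _ x
    obtain ⟨y, hy, z, hz, rfl⟩ := Submodule.mem_sup.mp ((Submodule.Quotient.mk_eq_zero _).mp hx)
    obtain ⟨c, rfl⟩ := Ideal.mem_span_singleton'.mp hz
    refine ⟨(Submodule.Quotient.mk c : R ⧸ I), ?_⟩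
    change a • (Submodule.Quotient.mk c : R ⧸ I) = _
    rw [← Submodule.Quotient.mk_smul, Submodule.Quotient.eq]
    have : a • c - (y + c * a) = -y := by simp only [smul_eq_mul]; ring
    rw [this]
    exact neg_mem hy
  · rw [ModuleCat.mono_iff_injective, injective_iff_map_eq_zero]
    intro (x : R ⧸ I) (hx : a • x = 0)
    obtain ⟨x, rfl⟩ := Submodule.Quotient.mk_surjective _ x
    rw [← Submodule.Quotient.mk_smul, Submodule.Quotient.mk_eq_zero] at hx
    exact (Submodule.Quotient.mk_eq_zero _).mpr (hreg x hx)
  · rw [ModuleCat.epi_iff_surjective]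
    exact Submodule.factor_surjective (le_sup_left : I ≤ I ⊔ Ideal.span {a})
  · ext
    change a ^ t • (Submodule.Quotient.mk 1 : R ⧸ J ^ t) = 0
    rw [← Submodule.Quotient.mk_smul, smul_eq_mul, mul_one]
    exact (Submodule.Quotient.mk_eq_zero _).mpr (Ideal.pow_mem_pow ha t)

theorem isZero_leftDerived_prod (A B X : ModuleCat.{0} R) (n : ℕ)
    (hA : IsZero (((homOp A).leftDerived n).obj X))
    (hB : IsZero (((homOp B).leftDerived n).obj X)) :
    IsZero (((homOp (ModuleCat.of R (A × B))).leftDerived n).obj X) := by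
  let T : ShortComplex (ModuleCat.{0} R) := ShortComplex.mk
    (X₁ := A) (X₂ := ModuleCat.of R (A × B)) (X₃ := B) (ModuleCat.ofHom (LinearMap.inl R A B))
    (ModuleCat.ofHom (LinearMap.snd R A B)) (by ext; rfl)
  have hT : T.ShortExact :=
    { exact := by
        rw [ShortComplex.moduleCat_exact_iff]
        rintro ⟨x, y⟩ (h : y = 0)
        exact ⟨x, Prod.ext rfl h.symm⟩
      mono_f := by
        rw [ModuleCat.mono_iff_injective]
        exact LinearMap.inl_injective
      epi_g := by
        rw [ModuleCat.epi_iff_surjective]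
        exact LinearMap.snd_surjective }
  exact isZero_leftDerived_X₂ (homOpShortComplex_shortExact hT) n X hB hA

/-- The short complex `R ⧸ (I₁ ⊓ I₂) → R ⧸ I₁ × R ⧸ I₂ → R ⧸ (I₁ ⊔ I₂)`. -/
noncomputable def infSupShortComplex (I₁ I₂ : Ideal R) : ShortComplex (ModuleCat.{0} R) :=
  ShortComplex.mk (X₁ := ModuleCat.of R (R ⧸ I₁ ⊓ I₂)) (X₂ := ModuleCat.of R ((R ⧸ I₁) × (R ⧸ I₂)))
    (X₃ := ModuleCat.of R (R ⧸ I₁ ⊔ I₂))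
    (ModuleCat.ofHom ((Submodule.factor inf_le_left).prod (Submodule.factor inf_le_right)))
    (ModuleCat.ofHom ((Submodule.factor le_sup_left).comp (LinearMap.fst R (R ⧸ I₁) (R ⧸ I₂)) -
      (Submodule.factor le_sup_right).comp (LinearMap.snd R (R ⧸ I₁) (R ⧸ I₂)))) (by
        ext
        change (Submodule.Quotient.mk 1 : R ⧸ I₁ ⊔ I₂) - Submodule.Quotient.mk 1 = 0
        exact sub_self _)

theorem infSupShortComplex_shortExact (I₁ I₂ : Ideal R) :
    (infSupShortComplex I₁ I₂).ShortExact where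
  exact := by
    rw [ShortComplex.moduleCat_exact_iff]
    rintro ⟨x, y⟩ h
    obtain ⟨x, rfl⟩ := Submodule.Quotient.mk_surjective _ x
    obtain ⟨y, rfl⟩ := Submodule.Quotient.mk_surjective _ y
    change (Submodule.Quotient.mk x : R ⧸ I₁ ⊔ I₂) - Submodule.Quotient.mk y = 0 at h
    rw [← Submodule.Quotient.mk_sub, Submodule.Quotient.mk_eq_zero] at h
    obtain ⟨u, hu, v, hv, huv⟩ := Submodule.mem_sup.mp h
    refine ⟨(Submodule.Quotient.mk (x - u) : R ⧸ I₁ ⊓ I₂), Prod.ext ?_ ?_⟩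
    · exact (Submodule.Quotient.eq _).mpr (by simpa using hu)
    · refine (Submodule.Quotient.eq _).mpr ?_
      have : x - u - y = v := by rw [sub_right_comm, ← huv]; ring
      change x - u - y ∈ I₂
      rwa [this]
  mono_f := by
    rw [ModuleCat.mono_iff_injective, injective_iff_map_eq_zero]
    intro x h
    obtain ⟨x, rfl⟩ := Submodule.Quotient.mk_surjective _ x
    have h₁ : (Submodule.Quotient.mk x : R ⧸ I₁) = 0 := congrArg Prod.fst h
    have h₂ : (Submodule.Quotient.mk x : R ⧸ I₂) = 0 := congrArg Prod.snd h
    rw [Submodule.Quotient.mk_eq_zero] at h₁ h₂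
    exact (Submodule.Quotient.mk_eq_zero _).mpr ⟨h₁, h₂⟩
  epi_g := by
    rw [ModuleCat.epi_iff_surjective]
    intro x
    obtain ⟨x, rfl⟩ := Submodule.Quotient.mk_surjective _ x
    refine ⟨(Submodule.Quotient.mk x, 0), ?_⟩
    change (Submodule.Quotient.mk x : R ⧸ I₁ ⊔ I₂) - Submodule.Quotient.mk 0 = _
    rw [Submodule.Quotient.mk_zero, sub_zero]

end TwoIdeals

section FacePrime

variable {k : Type} [Field k] {V : Type}

theorem mem_span_monomial_of_X_mul_mem {s : Set (V →₀ ℕ)} {a : V} (hs : ∀ e ∈ s, e a = 0)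
    {f : MvPolynomial V k} (h : X a * f ∈ Ideal.span ((fun e => monomial e (1 : k)) '' s)) :
    f ∈ Ideal.span ((fun e => monomial e (1 : k)) '' s) := by
  classical
  rw [mem_ideal_span_monomial_image] at h ⊢
  intro e he
  obtain ⟨d, hd, hde⟩ := h (Finsupp.single a 1 + e) (by
    rw [mem_support_iff, coeff_X_mul]
    exact mem_support_iff.mp he)
  refine ⟨d, hd, fun i => ?_⟩
  by_cases hi : i = a
  · simp [hi, hs d hd]
  · simpa [Finsupp.single_apply, Ne.symm hi] using hde i

theorem X_mem_facePrime {F : Finset V} {i : V} (hi : i ∉ F) :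
    (X i : MvPolynomial V k) ∈ facePrime k F :=
  Ideal.subset_span ⟨i, hi, rfl⟩

theorem facePrime_sq_eq_span (F : Finset V) :
    facePrime k F ^ 2 = Ideal.span ((fun e => monomial e (1 : k)) ''
      {e | ∃ i ∉ F, ∃ j ∉ F, e = Finsupp.single i 1 + Finsupp.single j 1}) := by
  rw [facePrime, sq, Ideal.span_mul_span']
  congr 1
  ext f
  simp only [Set.mem_mul, Set.mem_image, Set.mem_ofPred_eq]
  constructor
  · rintro ⟨_, ⟨i, hi, rfl⟩, _, ⟨j, hj, rfl⟩, rfl⟩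
    exact ⟨_, ⟨i, hi, j, hj, rfl⟩, by simp [X, monomial_mul]⟩
  · rintro ⟨_, ⟨i, hi, j, hj, rfl⟩, rfl⟩
    exact ⟨_, ⟨i, hi, rfl⟩, _, ⟨j, hj, rfl⟩, by simp [X, monomial_mul]⟩

theorem mem_facePrime_sq_of_X_mul_mem {F : Finset V} {a : V} (ha : a ∈ F) (f : MvPolynomial V k)
    (h : X a * f ∈ facePrime k F ^ 2) : f ∈ facePrime k F ^ 2 := by
  rw [facePrime_sq_eq_span] at h ⊢
  refine mem_span_monomial_of_X_mul_mem ?_ h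
  rintro _ ⟨i, hi, j, hj, rfl⟩
  simp [ne_of_mem_of_not_mem ha hi, ne_of_mem_of_not_mem ha hj]

theorem mem_facePrime_sq_sup_of_X_mul_mem {F : Finset V} {a b : V} (hb : b ∈ F) (hab : a ≠ b)
    (f : MvPolynomial V k) (h : X b * f ∈ facePrime k F ^ 2 ⊔ Ideal.span {X a}) :
    f ∈ facePrime k F ^ 2 ⊔ Ideal.span {X a} := by
  have hspan : (Ideal.span {X a} : Ideal (MvPolynomial V k)) =
      Ideal.span ((fun e => monomial e (1 : k)) '' {Finsupp.single a 1}) := by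
    rw [Set.image_singleton]; rfl
  rw [facePrime_sq_eq_span, hspan, ← Ideal.span_union, ← Set.image_union] at h ⊢
  refine mem_span_monomial_of_X_mul_mem ?_ h
  rintro _ (⟨i, hi, j, hj, rfl⟩ | rfl)
  · simp [ne_of_mem_of_not_mem hb hi, ne_of_mem_of_not_mem hb hj]
  · simp [hab.symm]

theorem X_mul_X_notMem_facePrime_sq_sup {F G : Finset V} {a b : V} (ha : a ∈ F) (hb : b ∈ G) :
    (X a * X b : MvPolynomial V k) ∉ facePrime k F ^ 2 ⊔ facePrime k G ^ 2 := by
  classical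
  rw [facePrime_sq_eq_span, facePrime_sq_eq_span, ← Ideal.span_union, ← Set.image_union,
    mem_ideal_span_monomial_image]
  intro h
  obtain ⟨_, ⟨i, hi, j, hj, rfl⟩ | ⟨i, hi, j, hj, rfl⟩, hle⟩ :=
    h (Finsupp.single a 1 + Finsupp.single b 1) (by simp [X, monomial_mul])
  · have hi' := ne_of_mem_of_not_mem ha hi
    have hj' := ne_of_mem_of_not_mem ha hj
    have h₁ := hle i
    have h₂ := hle j
    simp only [Finsupp.add_apply, Finsupp.single_apply, if_neg hi', if_neg hj'] at h₁ h₂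
    grind
  · have hi' := ne_of_mem_of_not_mem hb hi
    have hj' := ne_of_mem_of_not_mem hb hj
    have h₁ := hle i
    have h₂ := hle j
    simp only [Finsupp.add_apply, Finsupp.single_apply, if_neg hi', if_neg hj'] at h₁ h₂
    grind

theorem X_sq_mem_facePrime_sq_sup {F G : Finset V} (hFG : Disjoint F G) (i : V) :
    (X i ^ 2 : MvPolynomial V k) ∈ facePrime k F ^ 2 ⊔ facePrime k G ^ 2 := by
  by_cases hi : i ∈ F
  · exact Ideal.mem_sup_right (Ideal.pow_mem_pow
      (X_mem_facePrime (Finset.disjoint_left.mp hFG hi)) 2)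
  · exact Ideal.mem_sup_left (Ideal.pow_mem_pow (X_mem_facePrime hi) 2)

theorem ringKrullDim_quotient_facePrime_le (F : Finset V) :
    ringKrullDim (MvPolynomial V k ⧸ facePrime k F) ≤ F.card := by
  let f : MvPolynomial F k →+* MvPolynomial V k ⧸ facePrime k F :=
    (Ideal.Quotient.mk _).comp (rename Subtype.val).toRingHom
  have hf : Function.Surjective f := by
    intro y
    obtain ⟨p, rfl⟩ := Ideal.Quotient.mk_surjective y
    induction p using MvPolynomial.induction_on with
    | C r => exact ⟨C r, congrArg _ (rename_C _ r)⟩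
    | add p q hp hq =>
      obtain ⟨u, hu⟩ := hp
      obtain ⟨v, hv⟩ := hq
      exact ⟨u + v, by rw [map_add, map_add, hu, hv]⟩
    | mul_X p i hp =>
      obtain ⟨u, hu⟩ := hp
      by_cases hi : i ∈ F
      · refine ⟨u * X ⟨i, hi⟩, ?_⟩
        rw [map_mul, map_mul, hu]
        exact congrArg _ (congrArg _ (rename_X _ _))
      · refine ⟨0, ?_⟩
        rw [map_zero, map_mul, Ideal.Quotient.eq_zero_iff_mem.mpr
          (X_mem_facePrime hi), mul_zero]
  refine (ringKrullDim_le_of_surjective f hf).trans ?_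
  rw [MvPolynomial.ringKrullDim_of_isNoetherianRing, ringKrullDim_eq_zero_of_field]
  simp

theorem card_le_ringKrullDim_quotient {F : Finset V} {I : Ideal (MvPolynomial V k)}
    (hI : I ≤ facePrime k F) : (F.card : WithBot ℕ∞) ≤ ringKrullDim (MvPolynomial V k ⧸ I) := by
  classical
  let φ : MvPolynomial V k →ₐ[k] MvPolynomial F k :=
    aeval fun i => if hi : i ∈ F then X ⟨i, hi⟩ else 0
  have hφ : facePrime k F ≤ RingHom.ker φ.toRingHom := by
    rw [facePrime, Ideal.span_le]
    rintro _ ⟨i, hi, rfl⟩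
    simpa [φ, RingHom.mem_ker] using hi
  have hφs : Function.Surjective φ := fun p => ⟨rename Subtype.val p, by
    rw [aeval_rename]
    convert aeval_X_left_apply p
    ext i
    simp⟩
  let f : MvPolynomial V k ⧸ I →+* MvPolynomial F k :=
    Ideal.Quotient.lift I φ.toRingHom fun a ha => hφ (hI ha)
  have h := ringKrullDim_le_of_surjective f (Ideal.Quotient.lift_surjective_of_surjective _ _ hφs)
  rw [MvPolynomial.ringKrullDim_of_isNoetherianRing, ringKrullDim_eq_zero_of_field] at h
  simpa using h

end FacePrime

theorem ringKrullDim_quotient_le_of_forall_isPrime {R : Type*} [CommRing R] {I I₁ I₂ : Ideal R}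
    (h : ∀ p : Ideal R, p.IsPrime → I ≤ p → I₁ ≤ p ∨ I₂ ≤ p) {d : WithBot ℕ∞}
    (h₁ : ringKrullDim (R ⧸ I₁) ≤ d) (h₂ : ringKrullDim (R ⧸ I₂) ≤ d) :
    ringKrullDim (R ⧸ I) ≤ d := by
  have key : ∀ (K : Ideal R) (x : PrimeSpectrum.zeroLocus (I : Set R)), K ≤ x.1.asIdeal →
      ((Order.coheight x : ℕ∞) : WithBot ℕ∞) ≤ ringKrullDim (R ⧸ K) := by
    intro K x hx
    rw [Order.coheight_eq_krullDim_Ici, ringKrullDim_quotient]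
    exact Order.krullDim_le_of_strictMono
      (fun y : Set.Ici x =>
        (⟨y.1.1, fun r hr => y.2 (hx hr)⟩ : PrimeSpectrum.zeroLocus (K : Set R)))
      fun _ _ hyz => hyz
  rw [ringKrullDim_quotient, Order.krullDim_eq_iSup_coheight]
  refine iSup_le fun x => ?_
  rcases h x.1.asIdeal x.1.2 x.2 with hx | hx
  · exact (key I₁ x hx).trans h₁
  · exact (key I₂ x hx).trans h₂

section DisjointFaces

variable {k : Type} [Field k] {V : Type}

theorem X_mem_maxIdeal (i : V) : (X i : MvPolynomial V k) ∈ maxIdeal k V :=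
  Ideal.subset_span ⟨i, rfl⟩

theorem isZero_leftDerived_zero_facePrime_sq {F : Finset V} {a : V} (ha : a ∈ F) (t : ℕ) :
    IsZero (((homOp (ModuleCat.of (MvPolynomial V k)
      (MvPolynomial V k ⧸ facePrime k F ^ 2))).leftDerived 0).obj
      (ModuleCat.of (MvPolynomial V k) (MvPolynomial V k ⧸ maxIdeal k V ^ t))) :=
  isZero_leftDerived_zero_quotient (X_mem_maxIdeal a) (mem_facePrime_sq_of_X_mul_mem ha) t

theorem isZero_leftDerived_one_facePrime_sq {F : Finset V} {a b : V} (ha : a ∈ F) (hb : b ∈ F)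
    (hab : a ≠ b) (t : ℕ) :
    IsZero (((homOp (ModuleCat.of (MvPolynomial V k)
      (MvPolynomial V k ⧸ facePrime k F ^ 2))).leftDerived 1).obj
      (ModuleCat.of (MvPolynomial V k) (MvPolynomial V k ⧸ maxIdeal k V ^ t))) :=
  isZero_leftDerived_one_quotient (X_mem_maxIdeal a) (X_mem_maxIdeal b)
    (mem_facePrime_sq_of_X_mul_mem ha) (mem_facePrime_sq_sup_of_X_mul_mem hb hab) t

/-- `H¹(S/(P_F² ⊓ P_G²))` is the torsion submodule of `S/(P_F² + P_G²)`, since both `S/P_F²` and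
`S/P_G²` have depth at least two. -/
theorem exists_locCoh_one_injective {F G : Finset V} (hF : 1 < F.card) (hG : 1 < G.card) :
    ∃ f : locCoh k V (facePrime k F ^ 2 ⊓ facePrime k G ^ 2) 1 →ₗ[MvPolynomial V k]
        MvPolynomial V k ⧸ (facePrime k F ^ 2 ⊔ facePrime k G ^ 2),
      Function.Injective f ∧ ∀ b, b ∈ LinearMap.range f ↔
        ∃ t : ℕ, ∀ r ∈ maxIdeal k V ^ t, r • b = 0 := by
  obtain ⟨a, ha, b, hb, hab⟩ := Finset.one_lt_card.mp hF
  obtain ⟨c, hc, d, hd, hcd⟩ := Finset.one_lt_card.mp hG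
  exact localCohomology_one_exists_injective (maxIdeal k V) (infSupShortComplex_shortExact _ _)
    (fun t => isZero_leftDerived_prod _ _ _ 0 (isZero_leftDerived_zero_facePrime_sq ha t)
      (isZero_leftDerived_zero_facePrime_sq hc t))
    (fun t => isZero_leftDerived_prod _ _ _ 1 (isZero_leftDerived_one_facePrime_sq ha hb hab t)
      (isZero_leftDerived_one_facePrime_sq hc hd hcd t))

theorem subsingleton_locCoh_zero {F G : Finset V} (hF : F.Nonempty) (hG : G.Nonempty) :
    Subsingleton (locCoh k V (facePrime k F ^ 2 ⊓ facePrime k G ^ 2) 0) := by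
  obtain ⟨a, ha⟩ := hF
  obtain ⟨c, hc⟩ := hG
  obtain ⟨f, hf, hf'⟩ := localCohomology_zero_exists_injective (maxIdeal k V)
    (ModuleCat.of (MvPolynomial V k) (MvPolynomial V k ⧸ facePrime k F ^ 2 ⊓ facePrime k G ^ 2))
  refine subsingleton_of_forall_eq 0 fun y => hf ?_
  obtain ⟨t, ht⟩ := (hf' (f y)).mp ⟨y, rfl⟩
  obtain ⟨p, hp⟩ := Ideal.Quotient.mk_surjective (f y)
  have hmem : ∀ i : V, X i ^ t * p ∈ facePrime k F ^ 2 ⊓ facePrime k G ^ 2 := fun i => by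
    rw [← Ideal.Quotient.eq_zero_iff_mem, map_mul, hp]
    exact ht _ (Ideal.pow_mem_pow (X_mem_maxIdeal i) t)
  refine (hp.symm.trans ?_).trans (map_zero f).symm
  exact Ideal.Quotient.eq_zero_iff_mem.mpr
    ⟨mem_of_pow_mul_mem (mem_facePrime_sq_of_X_mul_mem ha) t (hmem a).1,
      mem_of_pow_mul_mem (mem_facePrime_sq_of_X_mul_mem hc) t (hmem c).2⟩

theorem isFiniteLength_locCoh_one [Finite V] {F G : Finset V} (hF : 1 < F.card) (hG : 1 < G.card)
    (hFG : Disjoint F G) :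
    IsFiniteLength (MvPolynomial V k) (locCoh k V (facePrime k F ^ 2 ⊓ facePrime k G ^ 2) 1) := by
  obtain ⟨f, hf, -⟩ := exists_locCoh_one_injective (k := k) hF hG
  have hint : Algebra.IsIntegral k
      (MvPolynomial V k ⧸ (facePrime k F ^ 2 ⊔ facePrime k G ^ 2)) := by
    refine ⟨fun y => ?_⟩
    obtain ⟨p, rfl⟩ := Ideal.Quotient.mk_surjective y
    induction p using MvPolynomial.induction_on with
    | C r => exact isIntegral_algebraMap
    | add p q hp hq => rw [map_add]; exact hp.add hq
    | mul_X p i hp =>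
      rw [map_mul]
      refine hp.mul (IsIntegral.of_pow two_pos ?_)
      rw [← map_pow, Ideal.Quotient.eq_zero_iff_mem.mpr (X_sq_mem_facePrime_sq_sup hFG i)]
      exact isIntegral_zero
  have : Module.Finite k (MvPolynomial V k ⧸ (facePrime k F ^ 2 ⊔ facePrime k G ^ 2)) :=
    Algebra.IsIntegral.finite
  have := isArtinian_of_tower (R := k) (S := MvPolynomial V k)
    (M := MvPolynomial V k ⧸ (facePrime k F ^ 2 ⊔ facePrime k G ^ 2)) inferInstance
  rw [isFiniteLength_iff_isNoetherian_isArtinian]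
  exact ⟨isNoetherian_of_injective f hf, isArtinian_of_injective f hf⟩

theorem exists_X_mul_X_smul_locCoh_one_ne_zero [Finite V] {F G : Finset V} (hF : 1 < F.card)
    (hG : 1 < G.card) (hFG : Disjoint F G) {a b : V} (ha : a ∈ F) (hb : b ∈ G) :
    ∃ y : locCoh k V (facePrime k F ^ 2 ⊓ facePrime k G ^ 2) 1,
      (X a * X b : MvPolynomial V k) • y ≠ 0 := by
  obtain ⟨f, -, hf⟩ := exists_locCoh_one_injective (k := k) hF hG
  obtain ⟨t, ht⟩ : ∃ t, maxIdeal k V ^ t ≤ facePrime k F ^ 2 ⊔ facePrime k G ^ 2 := by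
    refine Ideal.exists_pow_le_of_le_radical_of_fg ?_ (Submodule.fg_span (Set.finite_range _))
    rw [maxIdeal, Ideal.span_le]
    rintro _ ⟨i, rfl⟩
    exact ⟨2, X_sq_mem_facePrime_sq_sup hFG i⟩
  obtain ⟨y, hy⟩ := (hf (Ideal.Quotient.mk _ 1)).mpr
    ⟨t, fun r hr => by
      change Ideal.Quotient.mk _ (r * 1) = 0
      rw [mul_one]
      exact Ideal.Quotient.eq_zero_iff_mem.mpr (ht hr)⟩
  refine ⟨y, fun h => X_mul_X_notMem_facePrime_sq_sup (k := k) ha hb ?_⟩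
  have h' : (X a * X b : MvPolynomial V k) • f y = 0 := by rw [← map_smul, h, map_zero]
  rw [hy] at h'
  rw [← mul_one (X a * X b : MvPolynomial V k)]
  exact Ideal.Quotient.eq_zero_iff_mem.mp h'

theorem ringKrullDim_quotient_facePrime_sq_inf {F G : Finset V} (hFG : F.card = G.card) :
    ringKrullDim (MvPolynomial V k ⧸ (facePrime k F ^ 2 ⊓ facePrime k G ^ 2)) = F.card := by
  refine le_antisymm (ringKrullDim_quotient_le_of_forall_isPrime (fun p hp h => ?_)
    (ringKrullDim_quotient_facePrime_le F) (hFG ▸ ringKrullDim_quotient_facePrime_le G))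
    (card_le_ringKrullDim_quotient (inf_le_left.trans (Ideal.pow_le_self two_ne_zero)))
  exact (hp.inf_le.mp h).imp hp.le_of_pow_le hp.le_of_pow_le

theorem quotGCM_facePrime_sq_inf [Finite V] {F G : Finset V} (hF : F.card = 2) (hG : G.card = 2)
    (hFG : Disjoint F G) : quotGCM k V (facePrime k F ^ 2 ⊓ facePrime k G ^ 2) := by
  intro i hi
  rw [ringKrullDim_quotient_facePrime_sq_inf (hF.trans hG.symm), hF] at hi
  have hi2 : i < 2 := by
    have hi' : (i : WithBot ℕ∞) < (2 : ℕ) := hi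
    exact_mod_cast hi'
  interval_cases i
  · have := subsingleton_locCoh_zero (k := k) (F := F) (G := G)
      (Finset.card_pos.mp (by omega)) (Finset.card_pos.mp (by omega))
    exact .of_subsingleton
  · exact isFiniteLength_locCoh_one (by omega) (by omega) hFG

end DisjointFaces

theorem facets_indepComplex_squareGraph :
    facets (indepComplex squareGraph) = {{0, 2}, {1, 3}} := by
  have hmem : ∀ F : Finset (Fin 4),
      F ∈ indepComplex squareGraph ↔ F ⊆ {0, 2} ∨ F ⊆ {1, 3} := by
    simp only [indepComplex, squareGraph, SimpleGraph.fromRel_adj, Set.mem_ofPred_eq]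
    decide
  ext F
  simp only [facets, Set.mem_ofPred_eq, hmem, Set.mem_insert_iff, Set.mem_singleton_iff]
  revert F
  decide

theorem symbolicPower_squareGraph (k : Type) [Field k] (m : ℕ) :
    symbolicPower k (indepComplex squareGraph) m =
      facePrime k {0, 2} ^ m ⊓ facePrime k {1, 3} ^ m := by
  rw [symbolicPower, facets_indepComplex_squareGraph, iInf_pair]

/-- **Example 3.10.** For the 4-cycle `G` with edges `{12, 23, 34, 14}` and `I = I(G)`,
the ring `S/I^{(2)}` is generalized Cohen–Macaulay of dimension 2, there is an element of
`H^1_m(S/I^{(2)})` (in fact one of degree `0`) not killed by `x₁x₂`, hence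
`m² · H^1_m(S/I^{(2)}) ≠ 0` and `S/I^{(2)}` is not 2-Buchsbaum. -/
theorem square_not_two_buchsbaum (k : Type) [Field k] :
    quotGCM k (Fin 4) (symbolicPower k (indepComplex squareGraph) 2) ∧
    ringKrullDim (MvPolynomial (Fin 4) k ⧸ symbolicPower k (indepComplex squareGraph) 2)
      = 2 ∧
    (∃ y : locCoh k (Fin 4) (symbolicPower k (indepComplex squareGraph) 2) 1,
      (X 0 * X 1 : MvPolynomial (Fin 4) k) • y ≠ 0) ∧
    ¬ quotKBuchsbaum k (Fin 4) (symbolicPower k (indepComplex squareGraph) 2) 2 := by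
  rw [symbolicPower_squareGraph]
  have hdim := ringKrullDim_quotient_facePrime_sq_inf (k := k) (F := {0, 2})
    (G := ({1, 3} : Finset (Fin 4))) rfl
  obtain ⟨y, hy⟩ := exists_X_mul_X_smul_locCoh_one_ne_zero (k := k) (F := {0, 2})
    (G := ({1, 3} : Finset (Fin 4))) (a := 0) (b := 1) (by decide) (by decide) (by decide)
    (by decide) (by decide)
  refine ⟨quotGCM_facePrime_sq_inf rfl rfl (by decide), hdim, ⟨y, hy⟩, fun h => hy ?_⟩
  refine h 1 ?_ _ ?_ y
  · rw [hdim]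
    have h12 : ((1 : ℕ) : WithBot ℕ∞) < (2 : ℕ) := by norm_cast
    exact h12
  · rw [sq]
    exact Ideal.mul_mem_mul (X_mem_maxIdeal 0) (X_mem_maxIdeal 1)
end
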